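/- Let s ≥ 2 be an integer, r_1,...,r_s real numbers each greater than 1 and none of them an integer, and λ ≥ 1 a real number such that 1/r_1 + ... + 1/r_{s−1} + 1/(λ r_s) = 1. Then the sumset P + A = {p + a : p prime, a ∈ A} has positive lower asymptotic density; that is, there exist c > 0 and x_0 such that for all x ≥ x_0, #{n ≤ x : n = p + a for some prime p and some a ∈ A} ≥ c·x. -/

import Mathlib

/-- The set `A = { 2^⌊k_1^{r_1}⌋ + ... + 2^⌊k_{s-1}^{r_{s-1}}⌋ + 2^⌊⌊k_s^λ⌋^{r_s}⌋ }`,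
with `k_1, ..., k_s` ranging over positive integers (indices 0-based: the last index is
`s - 1`). -/
def romA (s : ℕ) (hs : 0 < s) (r : Fin s → ℝ) (lam : ℝ) : Set ℕ :=
  {n | ∃ k : Fin s → ℕ, (∀ i, 0 < k i) ∧
    n = (∑ i ∈ Finset.univ.filter (fun i : Fin s => (i : ℕ) < s - 1),
          2 ^ ⌊(k i : ℝ) ^ (r i)⌋₊)
      + 2 ^ ⌊((⌊(k ⟨s - 1, by omega⟩ : ℝ) ^ lam⌋₊ : ℕ) : ℝ) ^ (r ⟨s - 1, by omega⟩)⌋₊}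

open ArithmeticFunction in
/-- The sum of the Möbius function over the divisors of a squarefree `l` that are multiples of a
divisor `m` of `l`. -/
lemma sum_moebius_divisors_filter_dvd {l m : ℕ} (hl : Squarefree l) (hml : m ∣ l) :
    ∑ d ∈ l.divisors with m ∣ d, moebius d = if l = m then moebius m else 0 := by
  obtain ⟨k, rfl⟩ := hml
  have hm0 : m ≠ 0 := left_ne_zero_of_mul hl.ne_zero
  have hk0 : k ≠ 0 := right_ne_zero_of_mul hl.ne_zero
  have hco : m.Coprime k := Nat.coprime_of_squarefree_mul hl
  have himg : (m * k).divisors.filter (m ∣ ·) = k.divisors.image (m * ·) := by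
    ext d
    simp only [Finset.mem_filter, Nat.mem_divisors, Finset.mem_image]
    constructor
    · rintro ⟨⟨h1, -⟩, j, rfl⟩
      exact ⟨j, ⟨Nat.dvd_of_mul_dvd_mul_left (Nat.pos_of_ne_zero hm0) h1, hk0⟩, rfl⟩
    · rintro ⟨j, ⟨h1, -⟩, rfl⟩
      exact ⟨⟨Nat.mul_dvd_mul_left m h1, mul_ne_zero hm0 hk0⟩, dvd_mul_right _ _⟩
  rw [himg, Finset.sum_image fun a _ b _ h => Nat.eq_of_mul_eq_mul_left (Nat.pos_of_ne_zero hm0) h]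
  have h1 : ∀ j ∈ k.divisors, moebius (m * j) = moebius m * moebius j := fun j hj =>
    isMultiplicative_moebius.map_mul_of_coprime
      (hco.coprime_dvd_right (Nat.dvd_of_mem_divisors hj))
  rw [Finset.sum_congr rfl h1, ← Finset.mul_sum, ← coe_mul_zeta_apply,
    moebius_mul_coe_zeta]
  have h2 : (m * k = m) ↔ k = 1 := by
    constructor
    · intro h
      exact Nat.eq_of_mul_eq_mul_left (Nat.pos_of_ne_zero hm0) (by simpa using h)
    · rintro rfl; simp
  by_cases hk : k = 1 <;> simp [h2, hk]

namespace BoundingSieve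

open Nat ArithmeticFunction

/-- The denominator in the main term of the Selberg sieve of level `R`. -/
noncomputable def selbergSum (s : BoundingSieve) (R : ℕ) : ℝ :=
  ∑ l ∈ (divisors s.prodPrimes) with l ≤ R, s.selbergTerms l

/-- The optimal weights of the Selberg sieve of level `R`. -/
noncomputable def optimalWeights (s : BoundingSieve) (R : ℕ) (d : ℕ) : ℝ :=
  (s.nu d)⁻¹ * (moebius d : ℝ) *
    ((∑ l ∈ (divisors s.prodPrimes) with l ≤ R, if d ∣ l then s.selbergTerms l else 0) /
      s.selbergSum R)

variable (s : BoundingSieve) {R : ℕ}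

lemma selbergSum_pos (hR : 1 ≤ R) : 0 < s.selbergSum R := by
  refine Finset.sum_pos (fun l hl => ?_) ⟨1, ?_⟩
  · exact selbergTerms_pos (dvd_of_mem_divisors (Finset.mem_filter.1 hl).1)
  · simp [hR, prodPrimes_ne_zero]

lemma optimalWeights_one (hR : 1 ≤ R) : s.optimalWeights R 1 = 1 := by
  have := (s.selbergSum_pos hR).ne'
  simp only [optimalWeights, s.nu_mult.map_one, one_dvd, if_true]
  rw [← selbergSum, div_self this]
  simp

lemma optimalWeights_eq_zero {d : ℕ} (hd : R < d) : s.optimalWeights R d = 0 := by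
  have : ∑ l ∈ (divisors s.prodPrimes) with l ≤ R,
      (if d ∣ l then s.selbergTerms l else 0) = 0 := by
    refine Finset.sum_eq_zero fun l hl => if_neg fun h => ?_
    rw [Finset.mem_filter, mem_divisors] at hl
    have := Nat.le_of_dvd (Nat.pos_of_dvd_of_pos hl.1.1 (Nat.pos_of_ne_zero hl.1.2)) h
    lia
  rw [optimalWeights, this]
  simp

lemma abs_optimalWeights_le {d : ℕ} (hR : 1 ≤ R) (hd : d ∣ s.prodPrimes) :
    |s.optimalWeights R d| ≤ (s.nu d)⁻¹ := by
  have hG := s.selbergSum_pos hR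
  have hnu := nu_pos_of_dvd_prodPrimes hd
  have hterm : ∀ l ∈ (divisors s.prodPrimes).filter (· ≤ R), 0 ≤ s.selbergTerms l := fun l hl =>
    (selbergTerms_pos (dvd_of_mem_divisors (Finset.mem_filter.1 hl).1)).le
  have h0 : 0 ≤ ∑ l ∈ (divisors s.prodPrimes) with l ≤ R,
      (if d ∣ l then s.selbergTerms l else 0) :=
    Finset.sum_nonneg fun l hl => by split_ifs; exacts [hterm l hl, le_rfl]
  have h1 : ∑ l ∈ (divisors s.prodPrimes) with l ≤ R,
      (if d ∣ l then s.selbergTerms l else 0) ≤ s.selbergSum R :=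
    Finset.sum_le_sum fun l hl => by split_ifs; exacts [le_rfl, hterm l hl]
  rw [optimalWeights, abs_mul, abs_mul, abs_of_pos (inv_pos.2 hnu),
    abs_of_nonneg (div_nonneg h0 hG.le)]
  have h2 : |(moebius d : ℝ)| ≤ 1 := by
    rw [← Int.cast_abs]; exact_mod_cast abs_moebius_le_one
  have h3 := (div_le_one hG).2 h1
  calc _ ≤ (s.nu d)⁻¹ * 1 * 1 := by gcongr
    _ = _ := by ring

lemma sum_nu_mul_optimalWeights {m : ℕ} (hm : m ∣ s.prodPrimes) :
    ∑ d ∈ divisors s.prodPrimes, (if m ∣ d then s.nu d * s.optimalWeights R d else 0) =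
      if m ≤ R then (moebius m : ℝ) * s.selbergTerms m / s.selbergSum R else 0 := by
  have h1 : ∀ d ∈ divisors s.prodPrimes,
      (if m ∣ d then s.nu d * s.optimalWeights R d else 0) =
      ∑ l ∈ (divisors s.prodPrimes) with l ≤ R, (s.selbergTerms l / s.selbergSum R) *
        (if d ∣ l ∧ m ∣ d then (moebius d : ℝ) else 0) := by
    intro d hd
    have hnu : s.nu d ≠ 0 := nu_ne_zero (dvd_of_mem_divisors hd)
    split_ifs with h
    · rw [optimalWeights, ← mul_assoc, ← mul_assoc, mul_inv_cancel₀ hnu, one_mul, Finset.sum_div,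
        Finset.mul_sum]
      refine Finset.sum_congr rfl fun l _ => ?_
      simp only [h, and_true]
      split_ifs <;> ring
    · simp [h]
  rw [Finset.sum_congr rfl h1, Finset.sum_comm]
  have h2 : ∀ l ∈ (divisors s.prodPrimes).filter (· ≤ R),
      ∑ d ∈ divisors s.prodPrimes, (s.selbergTerms l / s.selbergSum R) *
        (if d ∣ l ∧ m ∣ d then (moebius d : ℝ) else 0) =
      if l = m then (moebius m : ℝ) * s.selbergTerms m / s.selbergSum R else 0 := by
    intro l hl
    have hl' := dvd_of_mem_divisors (Finset.mem_filter.1 hl).1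
    have hlsq := squarefree_of_dvd_prodPrimes hl'
    rw [← Finset.mul_sum, ← Finset.sum_filter]
    have h3 : (divisors s.prodPrimes).filter (fun d => d ∣ l ∧ m ∣ d) =
        l.divisors.filter (m ∣ ·) := by
      ext d
      simp only [Finset.mem_filter, mem_divisors]
      exact ⟨fun h => ⟨⟨h.2.1, hlsq.ne_zero⟩, h.2.2⟩,
        fun h => ⟨⟨h.1.1.trans hl', prodPrimes_ne_zero⟩, h.1.1, h.2⟩⟩
    rw [h3]
    by_cases hml : m ∣ l
    · have h4 := sum_moebius_divisors_filter_dvd hlsq hml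
      rw [← Int.cast_sum, h4]
      by_cases hlm : l = m
      · subst hlm; simp only [if_true]; ring
      · simp [hlm]
    · rw [if_neg (fun h => hml h.symm.dvd), Finset.sum_eq_zero, mul_zero]
      intro d hd
      rw [Finset.mem_filter, mem_divisors] at hd
      exact absurd (hd.2.trans hd.1.1) hml
  rw [Finset.sum_congr rfl h2, Finset.sum_ite_eq']
  simp [hm, prodPrimes_ne_zero]

lemma mainSum_optimalWeights (hR : 1 ≤ R) :
    s.mainSum (lambdaSquared (s.optimalWeights R)) = (s.selbergSum R)⁻¹ := by
  have hG := (s.selbergSum_pos hR).ne'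
  rw [mainSum_lambdaSquared_eq_sum_mul_sum_sq]
  have h1 : ∀ l ∈ divisors s.prodPrimes, (s.selbergTerms l)⁻¹ *
      (∑ d ∈ divisors s.prodPrimes, if l ∣ d then s.nu d * s.optimalWeights R d else 0) ^ 2 =
      if l ≤ R then s.selbergTerms l / s.selbergSum R ^ 2 else 0 := by
    intro l hl
    have hl' := dvd_of_mem_divisors hl
    have hg := (selbergTerms_pos hl').ne'
    rw [s.sum_nu_mul_optimalWeights hl']
    split_ifs
    · have h2 : (moebius l : ℝ) ^ 2 = 1 := by
        exact_mod_cast moebius_sq_eq_one_of_squarefree (squarefree_of_dvd_prodPrimes hl')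
      rw [div_pow, mul_pow, h2]
      field_simp
    · simp
  rw [Finset.sum_congr rfl h1, ← Finset.sum_filter, ← Finset.sum_div, ← selbergSum]
  field_simp

lemma errSum_lambdaSquared_le (w : ℕ → ℝ) :
    s.errSum (lambdaSquared w) ≤ ∑ d₁ ∈ divisors s.prodPrimes, ∑ d₂ ∈ divisors s.prodPrimes,
      |w d₁| * |w d₂| * |s.rem (d₁.lcm d₂)| := by
  have h1 : ∀ d ∈ divisors s.prodPrimes, |lambdaSquared w d| * |s.rem d| ≤
      ∑ d₁ ∈ divisors s.prodPrimes, ∑ d₂ ∈ divisors s.prodPrimes,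
        if d = d₁.lcm d₂ then |w d₁| * |w d₂| * |s.rem (d₁.lcm d₂)| else 0 := by
    intro d hd
    have hsub := divisors_subset_of_dvd prodPrimes_ne_zero (dvd_of_mem_divisors hd)
    have h2 : |lambdaSquared w d| ≤ ∑ d₁ ∈ divisors s.prodPrimes, ∑ d₂ ∈ divisors s.prodPrimes,
        if d = d₁.lcm d₂ then |w d₁| * |w d₂| else 0 := by
      calc |lambdaSquared w d| ≤ ∑ d₁ ∈ divisors d, ∑ d₂ ∈ divisors d,
            if d = d₁.lcm d₂ then |w d₁| * |w d₂| else 0 := by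
            refine (Finset.abs_sum_le_sum_abs _ _).trans (Finset.sum_le_sum fun d₁ _ => ?_)
            refine (Finset.abs_sum_le_sum_abs _ _).trans (Finset.sum_le_sum fun d₂ _ => ?_)
            split_ifs
            · rw [abs_mul]
            · simp
        _ ≤ ∑ d₁ ∈ divisors s.prodPrimes, ∑ d₂ ∈ divisors d,
            if d = d₁.lcm d₂ then |w d₁| * |w d₂| else 0 :=
          Finset.sum_le_sum_of_subset_of_nonneg hsub fun _ _ _ =>
            Finset.sum_nonneg fun _ _ => by positivity
        _ ≤ _ := Finset.sum_le_sum fun _ _ =>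
          Finset.sum_le_sum_of_subset_of_nonneg hsub fun _ _ _ => by positivity
    refine (mul_le_mul_of_nonneg_right h2 (abs_nonneg _)).trans_eq ?_
    simp_rw [Finset.sum_mul]
    refine Finset.sum_congr rfl fun d₁ _ => Finset.sum_congr rfl fun d₂ _ => ?_
    split_ifs with h
    · rw [h]
    · simp
  refine (Finset.sum_le_sum h1).trans_eq ?_
  rw [Finset.sum_comm]
  refine Finset.sum_congr rfl fun d₁ hd₁ => ?_
  rw [Finset.sum_comm]
  refine Finset.sum_congr rfl fun d₂ hd₂ => ?_
  rw [Finset.sum_ite_eq', if_pos]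
  exact mem_divisors.2 ⟨Nat.lcm_dvd (dvd_of_mem_divisors hd₁) (dvd_of_mem_divisors hd₂),
    prodPrimes_ne_zero⟩

/-- The Selberg upper bound sieve. -/
theorem siftedSum_le_selberg (hR : 1 ≤ R) :
    s.siftedSum ≤ s.totalMass / s.selbergSum R +
      ∑ d₁ ∈ (divisors s.prodPrimes) with d₁ ≤ R, ∑ d₂ ∈ (divisors s.prodPrimes) with d₂ ≤ R,
        (s.nu d₁)⁻¹ * (s.nu d₂)⁻¹ * |s.rem (d₁.lcm d₂)| := by
  have h := siftedSum_le_mainSum_errSum_of_upperMoebius (s := s) _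
    (upperMoebius_lambdaSquared _ (s.optimalWeights_one hR))
  rw [s.mainSum_optimalWeights hR] at h
  refine h.trans ?_
  rw [div_eq_mul_inv]
  refine add_le_add le_rfl ((s.errSum_lambdaSquared_le _).trans ?_)
  rw [Finset.sum_filter]
  refine Finset.sum_le_sum fun d₁ hd₁ => ?_
  split_ifs with h₁
  · rw [Finset.sum_filter]
    refine Finset.sum_le_sum fun d₂ hd₂ => ?_
    split_ifs with h₂
    · have h₃ := s.abs_optimalWeights_le hR (dvd_of_mem_divisors hd₁)
      have h₄ := (abs_nonneg _).trans h₃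
      have := s.abs_optimalWeights_le hR (dvd_of_mem_divisors hd₂)
      gcongr
    · rw [s.optimalWeights_eq_zero (not_le.1 h₂)]
      simp
  · rw [s.optimalWeights_eq_zero (not_le.1 h₁)]
    simp

end BoundingSieve

lemma sum_inv_sq_le_two (N : ℕ) : ∑ c ∈ Finset.Ioc 0 N, (1 : ℝ) / (c : ℝ) ^ 2 ≤ 2 := by
  rcases Nat.eq_zero_or_pos N with rfl | hN
  · simp
  have h : Finset.Ioc 0 N = insert 1 (Finset.Ioc 1 N) := by
    ext; simp only [Finset.mem_Ioc, Finset.mem_insert]; lia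
  rw [h, Finset.sum_insert (by simp)]
  have := sum_Ioc_inv_sq_le_sub (α := ℝ) one_ne_zero hN
  simp only [one_div]
  have h2 : (0 : ℝ) ≤ (N : ℝ)⁻¹ := by positivity
  norm_num at this ⊢
  linarith

/-- The sum of the reciprocals of the squarefree numbers up to `N`. -/
noncomputable def squarefreeHarmonic (N : ℕ) : ℝ :=
  ∑ d ∈ (Finset.Ioc 0 N) with Squarefree d, (1 : ℝ) / d

lemma log_le_two_mul_squarefreeHarmonic (N : ℕ) :
    Real.log (N + 1) ≤ 2 * squarefreeHarmonic N := by
  have h1 : Real.log (N + 1) ≤ ∑ n ∈ Finset.Ioc 0 N, (1 : ℝ) / n := by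
    have := log_add_one_le_harmonic N
    rw [harmonic_eq_sum_Icc] at this
    push_cast at this
    simpa [one_div, ← Finset.Icc_add_one_left_eq_Ioc] using this
  have hdec : ∀ n : ℕ, ∃ ab : ℕ × ℕ, ab.2 ^ 2 * ab.1 = n ∧ Squarefree ab.1 := fun n => by
    obtain ⟨a, b, h, h'⟩ := Nat.sq_mul_squarefree n
    exact ⟨(a, b), h, h'⟩
  choose g hg hg' using hdec
  refine h1.trans ?_
  have h2 : ∀ n ∈ Finset.Ioc 0 N, (1 : ℝ) / n = 1 / ((g n).2 : ℝ) ^ 2 * (1 / ((g n).1 : ℝ)) := by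
    intro n _
    conv_lhs => rw [← hg n]
    push_cast
    rw [one_div_mul_one_div]
  have hinj : Set.InjOn g (Finset.Ioc 0 N : Finset ℕ) := fun a _ b _ h => by
    rw [← hg a, ← hg b, h]
  rw [Finset.sum_congr rfl h2,
    ← Finset.sum_image (f := fun ab : ℕ × ℕ => 1 / (ab.2 : ℝ) ^ 2 * (1 / (ab.1 : ℝ))) hinj]
  calc _ ≤ ∑ ab ∈ (Finset.Ioc 0 N).filter Squarefree ×ˢ Finset.Ioc 0 N,
        1 / (ab.2 : ℝ) ^ 2 * (1 / (ab.1 : ℝ)) := by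
        refine Finset.sum_le_sum_of_subset_of_nonneg ?_ fun _ _ _ => by positivity
        intro ab hab
        obtain ⟨n, hn, rfl⟩ := Finset.mem_image.1 hab
        rw [Finset.mem_Ioc] at hn
        have e := hg n
        have ha : 0 < (g n).1 := Nat.pos_of_ne_zero fun h => by simp [h] at e; lia
        have hb : 0 < (g n).2 := Nat.pos_of_ne_zero fun h => by simp [h] at e; lia
        simp only [Finset.mem_product, Finset.mem_filter, Finset.mem_Ioc]
        refine ⟨⟨⟨ha, ?_⟩, hg' n⟩, hb, ?_⟩ <;> nlinarith [Nat.mul_le_mul hb hb]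
    _ = (∑ c ∈ Finset.Ioc 0 N, (1 : ℝ) / (c : ℝ) ^ 2) * squarefreeHarmonic N := by
        rw [Finset.sum_product, squarefreeHarmonic, Finset.sum_mul_sum, Finset.sum_comm]
    _ ≤ 2 * squarefreeHarmonic N := by
        refine mul_le_mul_of_nonneg_right (sum_inv_sq_le_two N) ?_
        exact Finset.sum_nonneg fun _ _ => by positivity

/-- Pairs of coprime squarefree numbers up to `N`. -/
def coprimeSquarefreePairs (N : ℕ) : Finset (ℕ × ℕ) :=
  ((Finset.Ioc 0 N).filter Squarefree ×ˢ (Finset.Ioc 0 N).filter Squarefree).filter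
    fun de => de.1.Coprime de.2

lemma squarefreeHarmonic_sq_le (N : ℕ) :
    squarefreeHarmonic N ^ 2 ≤
      2 * ∑ de ∈ coprimeSquarefreePairs N, (1 : ℝ) / de.1 * (1 / de.2) := by
  set Q := (Finset.Ioc 0 N).filter Squarefree with hQ
  have h0 : squarefreeHarmonic N ^ 2 = ∑ de ∈ Q ×ˢ Q, (1 : ℝ) / de.1 * (1 / de.2) := by
    rw [Finset.sum_product, sq, squarefreeHarmonic, Finset.sum_mul_sum]
  let g : ℕ × ℕ → ℕ × (ℕ × ℕ) := fun de =>
    (de.1.gcd de.2, (de.1 / de.1.gcd de.2, de.2 / de.1.gcd de.2))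
  have hmem : ∀ de ∈ Q ×ˢ Q, 0 < de.1 ∧ de.1 ≤ N ∧ Squarefree de.1 ∧
      0 < de.2 ∧ de.2 ≤ N ∧ Squarefree de.2 := by
    intro de hde
    simp only [hQ, Finset.mem_product, Finset.mem_filter, Finset.mem_Ioc] at hde
    tauto
  have hg1 : ∀ de : ℕ × ℕ, (g de).1 * (g de).2.1 = de.1 := fun de =>
    Nat.mul_div_cancel' (Nat.gcd_dvd_left _ _)
  have hg2 : ∀ de : ℕ × ℕ, (g de).1 * (g de).2.2 = de.2 := fun de =>
    Nat.mul_div_cancel' (Nat.gcd_dvd_right _ _)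
  have hinj : Set.InjOn g (Q ×ˢ Q : Finset (ℕ × ℕ)) := fun a _ b _ h => by
    ext
    · rw [← hg1 a, ← hg1 b, h]
    · rw [← hg2 a, ← hg2 b, h]
  have h2 : ∀ de ∈ Q ×ˢ Q, (1 : ℝ) / de.1 * (1 / de.2) =
      1 / ((g de).1 : ℝ) ^ 2 * (1 / ((g de).2.1 : ℝ) * (1 / ((g de).2.2 : ℝ))) := by
    intro de _
    conv_lhs => rw [← hg1 de, ← hg2 de]
    push_cast
    rw [one_div_mul_one_div, one_div_mul_one_div, one_div_mul_one_div]
    congr 1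
    ring
  rw [h0, Finset.sum_congr rfl h2, ← Finset.sum_image
    (f := fun x : ℕ × (ℕ × ℕ) => 1 / (x.1 : ℝ) ^ 2 * (1 / (x.2.1 : ℝ) * (1 / (x.2.2 : ℝ)))) hinj]
  calc _ ≤ ∑ x ∈ Finset.Ioc 0 N ×ˢ coprimeSquarefreePairs N,
        1 / (x.1 : ℝ) ^ 2 * (1 / (x.2.1 : ℝ) * (1 / (x.2.2 : ℝ))) := by
        refine Finset.sum_le_sum_of_subset_of_nonneg ?_ fun _ _ _ => by positivity
        intro x hx
        obtain ⟨de, hde, rfl⟩ := Finset.mem_image.1 hx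
        obtain ⟨a1, a2, a3, b1, b2, b3⟩ := hmem de hde
        have hgpos : 0 < de.1.gcd de.2 := Nat.gcd_pos_of_pos_left _ a1
        simp only [g, coprimeSquarefreePairs, Finset.mem_product, Finset.mem_filter,
          Finset.mem_Ioc]
        refine ⟨⟨hgpos, (Nat.gcd_le_left _ a1).trans a2⟩, ⟨⟨⟨?_, ?_⟩, ?_⟩, ⟨⟨?_, ?_⟩, ?_⟩⟩, ?_⟩
        · exact Nat.div_pos (Nat.gcd_le_left _ a1) hgpos
        · exact (Nat.div_le_self _ _).trans a2
        · exact a3.squarefree_of_dvd (Nat.div_dvd_of_dvd (Nat.gcd_dvd_left _ _))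
        · exact Nat.div_pos (Nat.gcd_le_right _ b1) hgpos
        · exact (Nat.div_le_self _ _).trans b2
        · exact b3.squarefree_of_dvd (Nat.div_dvd_of_dvd (Nat.gcd_dvd_right _ _))
        · exact Nat.coprime_div_gcd_div_gcd hgpos
    _ = (∑ c ∈ Finset.Ioc 0 N, (1 : ℝ) / (c : ℝ) ^ 2) *
          ∑ de ∈ coprimeSquarefreePairs N, (1 : ℝ) / de.1 * (1 / de.2) := by
        rw [Finset.sum_product, Finset.sum_mul_sum]
    _ ≤ _ := by
        refine mul_le_mul_of_nonneg_right (sum_inv_sq_le_two N) ?_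
        exact Finset.sum_nonneg fun _ _ => by positivity

/-- The number of roots of `z * (z + h)` modulo `d`. -/
noncomputable def rootCount (h d : ℕ) : ℕ := Nat.card {z : ZMod d // z * (z + h) = 0}

lemma rootCount_mul (h : ℕ) {m n : ℕ} (hmn : m.Coprime n) :
    rootCount h (m * n) = rootCount h m * rootCount h n := by
  rw [rootCount, rootCount, rootCount, ← Nat.card_prod]
  let e := ZMod.chineseRemainder hmn
  have key : ∀ z : ZMod (m * n), z * (z + h) = 0 ↔
      (e z).1 * ((e z).1 + h) = 0 ∧ (e z).2 * ((e z).2 + h) = 0 := by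
    intro z
    rw [← e.map_eq_zero_iff, map_mul, map_add, map_natCast, Prod.ext_iff]
    simp
  refine Nat.card_congr ((e.toEquiv.subtypeEquiv key).trans
    (Equiv.subtypeProdEquivProd (p := fun z : ZMod m => z * (z + h) = 0)
      (q := fun z : ZMod n => z * (z + h) = 0)))

lemma rootCount_one (h : ℕ) : rootCount h 1 = 1 := by
  rw [rootCount, Nat.card_eq_one_iff_unique]
  exact ⟨inferInstance, ⟨⟨0, by simp⟩⟩⟩

lemma rootCount_pos (h d : ℕ) [NeZero d] : 0 < rootCount h d := by
  rw [rootCount, Nat.card_pos_iff]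
  exact ⟨⟨⟨0, by simp⟩⟩, inferInstance⟩

lemma rootCount_le (h d : ℕ) [NeZero d] : rootCount h d ≤ d := by
  rw [rootCount]
  calc _ ≤ Nat.card (ZMod d) := Nat.card_le_card_of_injective _ Subtype.val_injective
    _ = d := Nat.card_zmod d

lemma rootCount_prime (h : ℕ) {p : ℕ} (hp : p.Prime) :
    rootCount h p = if p ∣ h then 1 else 2 := by
  have := Fact.mk hp
  have h1 : {z : ZMod p | z * (z + h) = 0} = {0, -(h : ZMod p)} := by
    ext z
    simp [add_eq_zero_iff_eq_neg]
  have h2 : rootCount h p = ({0, -(h : ZMod p)} : Set (ZMod p)).ncard := by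
    rw [← h1, rootCount, ← Nat.card_coe_set_eq]; rfl
  rw [h2]
  split_ifs with hd
  · simp [(ZMod.natCast_eq_zero_iff h p).2 hd]
  · rw [Set.ncard_pair]
    intro h0
    rw [eq_comm, neg_eq_zero] at h0
    exact hd ((ZMod.natCast_eq_zero_iff h p).1 h0)

lemma abs_card_filter_dvd_sub_le (h d X : ℕ) [NeZero d] :
    |(((Finset.range X).filter fun n => d ∣ n * (n + h)).card : ℝ) - rootCount h d / d * X| ≤
      rootCount h d := by
  classical
  set Z : Finset (ZMod d) := Finset.univ.filter fun z => z * (z + h) = 0 with hZ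
  have hcard : rootCount h d = Z.card := by
    rw [rootCount, Nat.card_eq_fintype_card, Fintype.card_subtype]
  have hd0 : (0 : ℝ) < d := Nat.cast_pos.2 (Nat.pos_of_ne_zero (NeZero.ne d))
  have h1 : ((Finset.range X).filter fun n => d ∣ n * (n + h)).card =
      ∑ z ∈ Z, ((Finset.range X).filter fun n : ℕ => (n : ZMod d) = z).card := by
    rw [Finset.card_eq_sum_card_fiberwise (f := fun n : ℕ => (n : ZMod d)) (t := Z)]
    · refine Finset.sum_congr rfl fun z hz => ?_
      congr 1
      ext n
      simp only [Finset.mem_filter, and_assoc, and_congr_right_iff, and_iff_right_iff_imp]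
      rintro - rfl
      rw [← ZMod.natCast_eq_zero_iff]
      simpa [hZ] using hz
    · intro n hn
      simp only [Finset.coe_filter, Set.mem_ofPred_eq] at hn
      have := (ZMod.natCast_eq_zero_iff _ _).2 hn.2
      simpa [hZ] using this
  have h2 : ∀ z ∈ Z, |(((Finset.range X).filter fun n : ℕ => (n : ZMod d) = z).card : ℝ)
      - X / d| ≤ 1 := by
    intro z _
    have h3 : ((Finset.range X).filter fun n : ℕ => (n : ZMod d) = z).card =
        X / d + if z.val % d < X % d then 1 else 0 := by
      rw [← Nat.count_modEq_card X (Nat.pos_of_ne_zero (NeZero.ne d)), Nat.count_eq_card_filter_range]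
      congr 1
      ext n
      simp only [Finset.mem_filter, and_congr_right_iff]
      intro _
      rw [← ZMod.natCast_eq_natCast_iff, ZMod.natCast_zmod_val]
    rw [h3]
    have e : (X : ℝ) = d * (X / d : ℕ) + (X % d : ℕ) := by exact_mod_cast (Nat.div_add_mod X d).symm
    have hlt : ((X % d : ℕ) : ℝ) < d := by
      exact_mod_cast Nat.mod_lt _ (Nat.pos_of_ne_zero (NeZero.ne d))
    have hnn : (0 : ℝ) ≤ ((X % d : ℕ) : ℝ) := Nat.cast_nonneg _
    have e2 : (X : ℝ) / d = (X / d : ℕ) + ((X % d : ℕ) : ℝ) / d := by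
      field_simp; linarith
    have e3 : ((X % d : ℕ) : ℝ) / d ≤ 1 := (div_le_one hd0).2 hlt.le
    have e4 : 0 ≤ ((X % d : ℕ) : ℝ) / d := by positivity
    rw [e2, abs_le]
    split_ifs <;> push_cast <;> constructor <;> linarith
  rw [h1, hcard]
  push_cast
  have h4 : (Z.card : ℝ) / d * X = ∑ z ∈ Z, (X : ℝ) / d := by
    rw [Finset.sum_const, nsmul_eq_mul]; ring
  rw [h4, ← Finset.sum_sub_distrib]
  refine (Finset.abs_sum_le_sum_abs _ _).trans ((Finset.sum_le_sum h2).trans ?_)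
  simp

/-- The factor `∏ (1 + 1 / p)` over the primes dividing `h`. -/
noncomputable def singularFactor (h : ℕ) : ℝ := ∏ p ∈ h.primeFactors, (1 + 1 / (p : ℝ))

lemma one_le_singularFactor (h : ℕ) : 1 ≤ singularFactor h := by
  have : ∏ p ∈ h.primeFactors, (1 : ℝ) ≤ singularFactor h :=
    Finset.prod_le_prod (fun _ _ => zero_le_one) fun p _ => by
      have : (0 : ℝ) ≤ 1 / p := by positivity
      linarith
  simpa using this

open ArithmeticFunction in
lemma card_filter_coprime_divisors {h m : ℕ} (hm : Squarefree m) :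
    ((m.divisors.filter fun v => v.Coprime h).card : ℝ) =
      ∏ p ∈ m.primeFactors, (if p ∣ h then (1 : ℝ) else 2) := by
  let f : ArithmeticFunction ℝ := ⟨fun v => if v ≠ 0 ∧ v.Coprime h then 1 else 0, by simp⟩
  have hf : f.IsMultiplicative := by
    refine ⟨by simp [f], fun {a b} hab => ?_⟩
    simp only [f, coe_mk, Nat.coprime_mul_iff_left, mul_ne_zero_iff]
    rw [ite_zero_mul_ite_zero, one_mul]
    refine if_congr ?_ rfl rfl
    tauto
  have h1 := hf.prodPrimeFactors_one_add_of_squarefree hm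
  have h2 : ∏ p ∈ m.primeFactors, (1 + f p) = ∏ p ∈ m.primeFactors,
      (if p ∣ h then (1 : ℝ) else 2) := by
    refine Finset.prod_congr rfl fun p hp => ?_
    have hp' := Nat.prime_of_mem_primeFactors hp
    simp only [f, coe_mk, hp'.coprime_iff_not_dvd, hp'.ne_zero, ne_eq, not_false_iff, true_and]
    split_ifs <;> norm_num
  rw [← h2, h1, Finset.card_filter]
  push_cast
  refine Finset.sum_congr rfl fun v hv => ?_
  simp [f, (Nat.pos_of_mem_divisors hv).ne']

lemma rootCount_eq_prod {h m : ℕ} (hm : Squarefree m) :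
    (rootCount h m : ℝ) = ∏ p ∈ m.primeFactors, (if p ∣ h then (1 : ℝ) else 2) := by
  induction m using Nat.recOnPosPrimePosCoprime with
  | zero => simp at hm
  | one => simp [rootCount_one]
  | prime_pow p n hp hn =>
    have hn1 : n = 1 := ((Nat.squarefree_pow_iff hp.ne_one hn.ne').1 hm).2
    subst hn1
    rw [pow_one, rootCount_prime h hp, hp.primeFactors]
    simp
  | coprime a b ha hb hab iha ihb =>
    rw [rootCount_mul h hab, Nat.cast_mul, iha (hm.of_mul_left), ihb (hm.of_mul_right),
      hab.primeFactors_mul, Finset.prod_union hab.disjoint_primeFactors]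

lemma sum_squarefree_divisors_inv {h : ℕ} (hh : h ≠ 0) :
    ∑ u ∈ h.divisors with Squarefree u, (1 : ℝ) / u = singularFactor h := by
  let f : ArithmeticFunction ℝ := ⟨fun v => 1 / (v : ℝ), by simp⟩
  have hf : f.IsMultiplicative := by
    refine ⟨by simp [f], fun {a b} _ => ?_⟩
    simp [f, mul_comm]
  have hsq : Squarefree (∏ p ∈ h.primeFactors, p) := by
    refine Finset.squarefree_prod_of_pairwise_isCoprime ?_ ?_
    · intro p hp q hq hpq
      exact Nat.coprime_iff_isRelPrime.1 ((Nat.coprime_primes (Nat.prime_of_mem_primeFactors hp)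
        (Nat.prime_of_mem_primeFactors hq)).2 hpq)
    · exact fun p hp => (Nat.prime_of_mem_primeFactors hp).squarefree
  have h1 := hf.prodPrimeFactors_one_add_of_squarefree hsq
  rw [Nat.primeFactors_prod fun p hp => Nat.prime_of_mem_primeFactors hp] at h1
  have h2 : h.divisors.filter Squarefree = (∏ p ∈ h.primeFactors, p).divisors := by
    ext u
    simp only [Finset.mem_filter, Nat.mem_divisors]
    constructor
    · rintro ⟨⟨hu, -⟩, husq⟩
      refine ⟨?_, hsq.ne_zero⟩
      rw [← Nat.prod_primeFactors_of_squarefree husq]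
      exact Finset.prod_dvd_prod_of_subset _ _ _ (Nat.primeFactors_mono hu hh)
    · rintro ⟨hu, -⟩
      exact ⟨⟨hu.trans (Nat.prod_primeFactors_dvd h), hh⟩, hsq.squarefree_of_dvd hu⟩
  rw [h2, singularFactor]
  exact h1.symm

lemma sum_coprimeSquarefreePairs_le {h N R : ℕ} (hh : h ≠ 0) (hNR : N * N ≤ R) :
    ∑ de ∈ coprimeSquarefreePairs N, (1 : ℝ) / de.1 * (1 / de.2) ≤
      (∑ m ∈ (Finset.Ioc 0 R) with Squarefree m, (rootCount h m : ℝ) / m) * singularFactor h := by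
  set U := h.divisors.filter Squarefree with hU
  let g : ℕ × ℕ → (_ : ℕ) × (ℕ × ℕ) := fun de =>
    ⟨de.1 * (de.2 / de.2.gcd h), (de.2 / de.2.gcd h, de.2.gcd h)⟩
  have hg2 : ∀ de : ℕ × ℕ, (g de).2.1 * (g de).2.2 = de.2 := fun de =>
    Nat.div_mul_cancel (Nat.gcd_dvd_left _ _)
  have hinj : Set.InjOn g (coprimeSquarefreePairs N : Finset (ℕ × ℕ)) := by
    intro a ha b hb hab
    have e2 : a.2 = b.2 := by rw [← hg2 a, ← hg2 b, hab]
    have e1 : a.1 * (a.2 / a.2.gcd h) = b.1 * (b.2 / b.2.gcd h) := congrArg Sigma.fst hab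
    simp only [coprimeSquarefreePairs, Finset.coe_filter, Finset.mem_product, Finset.mem_filter,
      Finset.mem_Ioc, Set.mem_ofPred_eq] at ha
    rw [← e2] at e1
    have hpos : 0 < a.2 / a.2.gcd h :=
      Nat.div_pos (Nat.gcd_le_left _ ha.1.2.1.1) (Nat.gcd_pos_of_pos_left _ ha.1.2.1.1)
    exact Prod.ext (Nat.eq_of_mul_eq_mul_right hpos e1) e2
  have hval : ∀ de ∈ coprimeSquarefreePairs N, (1 : ℝ) / de.1 * (1 / de.2) =
      1 / ((g de).1 : ℝ) * (1 / ((g de).2.2 : ℝ)) := by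
    intro de _
    conv_lhs => rw [← hg2 de]
    simp only [g]
    push_cast
    rw [one_div_mul_one_div, one_div_mul_one_div]
    congr 1
    ring
  rw [Finset.sum_congr rfl hval, ← Finset.sum_image
    (f := fun x : (_ : ℕ) × (ℕ × ℕ) => 1 / (x.1 : ℝ) * (1 / (x.2.2 : ℝ))) hinj]
  calc _ ≤ ∑ x ∈ ((Finset.Ioc 0 R).filter Squarefree).sigma
          (fun m => (m.divisors.filter fun v => v.Coprime h) ×ˢ U),
        1 / (x.1 : ℝ) * (1 / (x.2.2 : ℝ)) := by
        refine Finset.sum_le_sum_of_subset_of_nonneg ?_ fun _ _ _ => by positivity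
        intro x hx
        obtain ⟨de, hde, rfl⟩ := Finset.mem_image.1 hx
        simp only [coprimeSquarefreePairs, Finset.mem_product, Finset.mem_filter,
          Finset.mem_Ioc] at hde
        obtain ⟨⟨⟨⟨a1, a2⟩, a3⟩, ⟨b1, b2⟩, b3⟩, hco⟩ := hde
        have hgd := Nat.gcd_dvd_left de.2 h
        have hgpos : 0 < de.2.gcd h := Nat.gcd_pos_of_pos_left _ b1
        have hvd : de.2 / de.2.gcd h ∣ de.2 := Nat.div_dvd_of_dvd hgd
        have hvpos : 0 < de.2 / de.2.gcd h := Nat.div_pos (Nat.gcd_le_left _ b1) hgpos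
        have hsq : Squarefree (de.1 * (de.2 / de.2.gcd h)) :=
          Nat.squarefree_mul_iff.2 ⟨hco.coprime_dvd_right hvd, a3, b3.squarefree_of_dvd hvd⟩
        simp only [g, hU, Finset.mem_sigma, Finset.mem_product, Finset.mem_filter,
          Finset.mem_Ioc, Nat.mem_divisors]
        refine ⟨⟨⟨Nat.mul_pos a1 hvpos, ?_⟩, hsq⟩, ⟨⟨dvd_mul_left _ _, hsq.ne_zero⟩, ?_⟩,
          ⟨Nat.gcd_dvd_right _ _, hh⟩, b3.squarefree_of_dvd hgd⟩
        · exact (Nat.mul_le_mul a2 ((Nat.div_le_self _ _).trans b2)).trans hNR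
        · rw [Nat.coprime_iff_gcd_eq_one]
          have hco2 : (de.2 / de.2.gcd h).Coprime (de.2.gcd h) :=
            Nat.coprime_of_squarefree_mul (by rwa [Nat.div_mul_cancel hgd])
          have hd2 : (de.2 / de.2.gcd h).gcd h ∣ de.2.gcd h :=
            Nat.dvd_gcd ((Nat.gcd_dvd_left _ _).trans hvd) (Nat.gcd_dvd_right _ _)
          exact Nat.eq_one_of_dvd_coprimes hco2 (Nat.gcd_dvd_left _ _) hd2
    _ = _ := by
        rw [Finset.sum_sigma, Finset.sum_mul]
        refine Finset.sum_congr rfl fun m hm => ?_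
        have hmsq := (Finset.mem_filter.1 hm).2
        rw [rootCount_eq_prod hmsq, ← card_filter_coprime_divisors hmsq, Finset.sum_product]
        dsimp only
        rw [Finset.sum_const, nsmul_eq_mul, ← Finset.mul_sum, sum_squarefree_divisors_inv hh]
        ring

/-- The sieve problem for the values `n * (n + h)`, `n < X`, sifted by the primes up to `R`. -/
noncomputable def primePairSieve (h : ℕ) (hh : Even h) (X R : ℕ) : BoundingSieve where
  support := (Finset.range X).image fun n => n * (n + h)
  prodPrimes := primorial R
  prodPrimes_squarefree := by
    refine Finset.squarefree_prod_of_pairwise_isCoprime ?_ ?_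
    · intro p hp q hq hpq
      simp only [Finset.coe_filter, Set.mem_ofPred_eq] at hp hq
      exact Nat.coprime_iff_isRelPrime.1 ((Nat.coprime_primes hp.2 hq.2).2 hpq)
    · exact fun p hp => (Finset.mem_filter.1 hp).2.squarefree
  weights := fun _ => 1
  weights_nonneg := fun _ => zero_le_one
  totalMass := X
  nu := ⟨fun d => (rootCount h d : ℝ) / d, by simp⟩
  nu_mult := by
    refine ⟨by simp [rootCount_one], fun {a b} hab => ?_⟩
    simp only [ArithmeticFunction.coe_mk, rootCount_mul h hab]
    push_cast
    rw [mul_div_mul_comm]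
  nu_pos_of_prime := by
    intro p hp _
    have := NeZero.mk hp.ne_zero
    have h1 := rootCount_pos h p
    have h2 := hp.pos
    simp only [ArithmeticFunction.coe_mk]
    positivity
  nu_lt_one_of_prime := by
    intro p hp _
    have h2 : (0 : ℝ) < p := Nat.cast_pos.2 hp.pos
    simp only [ArithmeticFunction.coe_mk]
    rw [div_lt_one h2, rootCount_prime h hp, Nat.cast_lt]
    split_ifs with hd
    · exact hp.one_lt
    · refine lt_of_le_of_ne hp.two_le ?_
      rintro rfl
      exact hd hh.two_dvd

lemma injective_mul_add (h : ℕ) : Function.Injective fun n : ℕ => n * (n + h) := by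
  have : StrictMono fun n : ℕ => n * (n + h) := by
    refine strictMono_nat_of_lt_succ fun n => ?_
    nlinarith
  exact this.injective

lemma dvd_primorial_of_squarefree {R m : ℕ} (hm : Squarefree m) (hmR : m ≤ R) :
    m ∣ primorial R := by
  rw [← Nat.prod_primeFactors_of_squarefree hm, primorial]
  refine Finset.prod_dvd_prod_of_subset _ _ _ fun p hp => ?_
  have := Nat.le_of_mem_primeFactors hp
  simp only [Finset.mem_filter, Finset.mem_range]
  exact ⟨by lia, Nat.prime_of_mem_primeFactors hp⟩

lemma log_sq_le_selbergSum {h : ℕ} (hh : Even h) (hh0 : h ≠ 0) (X : ℕ) {N R : ℕ}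
    (hNR : N * N ≤ R) :
    Real.log (N + 1) ^ 2 ≤
      8 * ((primePairSieve h hh X R).selbergSum R * singularFactor h) := by
  set s := primePairSieve h hh X R with hs
  have h1 := log_le_two_mul_squarefreeHarmonic N
  have h2 := squarefreeHarmonic_sq_le N
  have h3 := sum_coprimeSquarefreePairs_le hh0 hNR
  have h0 : 0 ≤ Real.log (N + 1) := Real.log_nonneg (by linarith [Nat.cast_nonneg (α := ℝ) N])
  have h4 : ∑ m ∈ (Finset.Ioc 0 R) with Squarefree m, (rootCount h m : ℝ) / m ≤
      s.selbergSum R := by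
    calc ∑ m ∈ (Finset.Ioc 0 R) with Squarefree m, (rootCount h m : ℝ) / m
        ≤ ∑ m ∈ (Finset.Ioc 0 R) with Squarefree m, s.selbergTerms m := by
          refine Finset.sum_le_sum fun m hm => ?_
          rw [Finset.mem_filter, Finset.mem_Ioc] at hm
          have hmd : m ∣ s.prodPrimes := dvd_primorial_of_squarefree hm.2 hm.1.2
          rw [BoundingSieve.selbergTerms_apply]
          have hnu : s.nu m = rootCount h m / m := rfl
          rw [← hnu]
          refine le_mul_of_one_le_right (BoundingSieve.nu_pos_of_dvd_prodPrimes hmd).le ?_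
          have : ∏ p ∈ m.primeFactors, (1 : ℝ) ≤ ∏ p ∈ m.primeFactors, (1 - s.nu p)⁻¹ := by
            refine Finset.prod_le_prod (fun _ _ => zero_le_one) fun p hp => ?_
            have hp' := Nat.prime_of_mem_primeFactors hp
            have hpd := (Nat.dvd_of_mem_primeFactors hp).trans hmd
            have h5 := s.nu_pos_of_prime p hp' hpd
            have h6 := s.nu_lt_one_of_prime p hp' hpd
            exact (one_le_inv₀ (by linarith)).2 (by linarith)
          simpa using this
      _ ≤ s.selbergSum R := by
          refine Finset.sum_le_sum_of_subset_of_nonneg ?_ fun l hl _ =>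
            (BoundingSieve.selbergTerms_pos
              (Nat.dvd_of_mem_divisors (Finset.mem_filter.1 hl).1)).le
          intro m hm
          rw [Finset.mem_filter, Finset.mem_Ioc] at hm
          rw [Finset.mem_filter, Nat.mem_divisors]
          exact ⟨⟨dvd_primorial_of_squarefree hm.2 hm.1.2, BoundingSieve.prodPrimes_ne_zero⟩,
            hm.1.2⟩
  have h5 := one_le_singularFactor h
  have h6 := mul_le_mul_of_nonneg_right h4 (zero_le_one.trans h5)
  have h7 : Real.log (N + 1) ^ 2 ≤ (2 * squarefreeHarmonic N) ^ 2 := by gcongr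
  nlinarith

/-- Selberg sieve bound for pairs of primes with difference `h`. -/
lemma card_primePairs_le {h : ℕ} (hh : Even h) (hh0 : h ≠ 0) (X : ℕ) {N : ℕ} (hN : 1 ≤ N) :
    (((Finset.range X).filter fun n => n.Prime ∧ (n + h).Prime).card : ℝ) ≤
      8 * X * singularFactor h / Real.log (N + 1) ^ 2 + 2 * (N : ℝ) ^ 12 := by
  set R := N * N with hR
  have hR1 : 1 ≤ R := Nat.mul_pos hN hN
  set s := primePairSieve h hh X R with hs
  have hsift : s.siftedSum =
      ((Finset.range X).filter fun n => (primorial R).Coprime (n * (n + h))).card := by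
    have : s.siftedSum = ∑ d ∈ (Finset.range X).image fun n => n * (n + h),
      if (primorial R).Coprime d then (1 : ℝ) else 0 := rfl
    rw [this, Finset.sum_image (injective_mul_add h).injOn, Finset.card_filter]
    push_cast
    rfl
  have hcard : ((Finset.range X).filter fun n => n.Prime ∧ (n + h).Prime).card ≤
      ((Finset.range X).filter fun n => (primorial R).Coprime (n * (n + h))).card + R := by
    calc _ ≤ (((Finset.range X).filter fun n => (primorial R).Coprime (n * (n + h))) ∪
          Finset.Ioc 0 R).card := by
          refine Finset.card_le_card fun n hn => ?_
          simp only [Finset.mem_filter, Finset.mem_range, Finset.mem_union, Finset.mem_Ioc] at hn ⊢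
          by_cases hnR : n ≤ R
          · exact Or.inr ⟨hn.2.1.pos, hnR⟩
          · left
            refine ⟨hn.1, ?_⟩
            have hc : ∀ q : ℕ, q.Prime → R < q → (primorial R).Coprime q := by
              intro q hq hqR
              refine Nat.Coprime.symm ((hq.coprime_iff_not_dvd).2 fun hd => ?_)
              exact absurd (hq.dvd_primorial_iff.1 hd) (by lia)
            exact Nat.Coprime.mul_right (hc n hn.2.1 (by lia)) (hc (n + h) hn.2.2 (by lia))
      _ ≤ _ := (Finset.card_union_le _ _).trans (by simp)
  have hrem : ∀ d : ℕ, d ≠ 0 → |s.rem d| ≤ rootCount h d := by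
    intro d hd
    have := NeZero.mk hd
    have e : s.rem d = (((Finset.range X).filter fun n => d ∣ n * (n + h)).card : ℝ) -
        rootCount h d / d * X := by
      have : s.rem d = (∑ n ∈ (Finset.range X).image fun n => n * (n + h),
        if d ∣ n then (1 : ℝ) else 0) - (rootCount h d : ℝ) / d * X := rfl
      rw [this, Finset.sum_image (injective_mul_add h).injOn, Finset.card_filter]
      push_cast
      rfl
    rw [e]
    exact abs_card_filter_dvd_sub_le h d X
  have hnuinv : ∀ d : ℕ, d ≠ 0 → (s.nu d)⁻¹ ≤ d := by
    intro d hd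
    have := NeZero.mk hd
    have h1 : (1 : ℝ) ≤ rootCount h d := by exact_mod_cast rootCount_pos h d
    have e : s.nu d = rootCount h d / d := rfl
    rw [e, inv_div]
    exact div_le_self (Nat.cast_nonneg d) h1
  have herr : ∑ d₁ ∈ s.prodPrimes.divisors with d₁ ≤ R, ∑ d₂ ∈ s.prodPrimes.divisors with d₂ ≤ R,
        (s.nu d₁)⁻¹ * (s.nu d₂)⁻¹ * |s.rem (d₁.lcm d₂)| ≤ (R : ℝ) ^ 6 := by
    have hD : (s.prodPrimes.divisors.filter (· ≤ R)).card ≤ R := by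
      calc _ ≤ (Finset.Ioc 0 R).card := Finset.card_le_card fun d hd => by
            rw [Finset.mem_filter] at hd
            exact Finset.mem_Ioc.2 ⟨Nat.pos_of_mem_divisors hd.1, hd.2⟩
        _ = R := by simp
    have hterm : ∀ d₁ ∈ s.prodPrimes.divisors.filter (· ≤ R),
        ∀ d₂ ∈ s.prodPrimes.divisors.filter (· ≤ R),
        (s.nu d₁)⁻¹ * (s.nu d₂)⁻¹ * |s.rem (d₁.lcm d₂)| ≤ (R : ℝ) ^ 4 := by
      intro d₁ h₁ d₂ h₂
      rw [Finset.mem_filter] at h₁ h₂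
      have p₁ := (Nat.pos_of_mem_divisors h₁.1).ne'
      have p₂ := (Nat.pos_of_mem_divisors h₂.1).ne'
      have pl : d₁.lcm d₂ ≠ 0 := Nat.lcm_ne_zero p₁ p₂
      have := NeZero.mk pl
      have b₁ : (d₁ : ℝ) ≤ R := Nat.cast_le.2 h₁.2
      have b₂ : (d₂ : ℝ) ≤ R := Nat.cast_le.2 h₂.2
      have bl : |s.rem (d₁.lcm d₂)| ≤ R * R := by
        refine (hrem _ pl).trans ?_
        have : rootCount h (d₁.lcm d₂) ≤ R * R := (rootCount_le h _).trans
          ((Nat.lcm_le_mul (Nat.pos_of_ne_zero p₁) (Nat.pos_of_ne_zero p₂)).trans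
            (Nat.mul_le_mul h₁.2 h₂.2))
        exact_mod_cast this
      have c₁ := (hnuinv d₁ p₁).trans b₁
      have c₂ := (hnuinv d₂ p₂).trans b₂
      have n₁ := (BoundingSieve.nu_pos_of_dvd_prodPrimes (Nat.dvd_of_mem_divisors h₁.1)).le
      have n₂ := (BoundingSieve.nu_pos_of_dvd_prodPrimes (Nat.dvd_of_mem_divisors h₂.1)).le
      calc _ ≤ (R : ℝ) * R * (R * R) := by
            gcongr
        _ = _ := by ring
    calc _ ≤ ∑ d₁ ∈ s.prodPrimes.divisors with d₁ ≤ R, ∑ d₂ ∈ s.prodPrimes.divisors with d₂ ≤ R,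
          (R : ℝ) ^ 4 := Finset.sum_le_sum fun d₁ h₁ => Finset.sum_le_sum fun d₂ h₂ =>
            hterm d₁ h₁ d₂ h₂
      _ = (s.prodPrimes.divisors.filter (· ≤ R)).card *
          ((s.prodPrimes.divisors.filter (· ≤ R)).card * (R : ℝ) ^ 4) := by
          simp [Finset.sum_const, nsmul_eq_mul]
      _ ≤ (R : ℝ) * (R * (R : ℝ) ^ 4) := by gcongr
      _ = _ := by ring
  have hsel := s.siftedSum_le_selberg hR1
  have hlog := log_sq_le_selbergSum hh hh0 X hR.ge
  rw [← hs] at hlog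
  have hG := s.selbergSum_pos hR1
  have hN0 : (1 : ℝ) ≤ N := by exact_mod_cast hN
  have hlogpos : 0 < Real.log (N + 1) := Real.log_pos (by linarith)
  have hmain : s.totalMass / s.selbergSum R ≤ 8 * X * singularFactor h / Real.log (N + 1) ^ 2 := by
    have e : s.totalMass = X := rfl
    rw [e, div_le_div_iff₀ hG (by positivity)]
    have := mul_le_mul_of_nonneg_left hlog (Nat.cast_nonneg (α := ℝ) X)
    linarith
  have hc : (((Finset.range X).filter fun n => n.Prime ∧ (n + h).Prime).card : ℝ) ≤
      s.siftedSum + R := by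
    rw [hsift]; exact_mod_cast hcard
  have hRN : (R : ℝ) = (N : ℝ) ^ 2 := by rw [hR]; push_cast; ring
  have hR6 : (R : ℝ) ≤ (N : ℝ) ^ 12 := by
    rw [hRN]; exact pow_le_pow_right₀ hN0 (by norm_num)
  have hR6' : (R : ℝ) ^ 6 = (N : ℝ) ^ 12 := by rw [hRN]; ring
  linarith

lemma card_le_add_sum_card_shift {K H : ℕ} (hH : 1 ≤ H) {S : Finset ℕ}
    (hS : S ⊆ Finset.Ico K (2 * K)) :
    S.card ≤ (2 * K / H + 1) + ∑ h ∈ Finset.Ico 1 H, (S.filter fun k => k + h ∈ S).card := by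
  set T := S.filter fun k => ∀ h ∈ Finset.Ico 1 H, k + h ∉ S with hT
  have h1 : T.card ≤ 2 * K / H + 1 := by
    rw [← Finset.card_range (2 * K / H + 1)]
    refine Finset.card_le_card_of_injOn (fun k => k / H) ?_ ?_
    · intro k hk
      have := Finset.mem_Ico.1 (hS (Finset.mem_filter.1 hk).1)
      exact Finset.mem_coe.2 (Finset.mem_range.2 (Nat.lt_succ_of_le (Nat.div_le_div_right this.2.le)))
    · have key : ∀ a ∈ T, ∀ b ∈ T, a / H = b / H → ¬ a < b := by
        intro a ha b hb hab hlt
        have hd : b - a < H := by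
          have e1 := Nat.div_add_mod a H
          have e2 := Nat.div_add_mod b H
          have e3 := Nat.mod_lt b hH
          rw [hab] at e1
          lia
        refine (Finset.mem_filter.1 ha).2 (b - a) (Finset.mem_Ico.2 ⟨by lia, hd⟩) ?_
        rw [Nat.add_sub_cancel' hlt.le]
        exact (Finset.mem_filter.1 hb).1
      intro a ha b hb hab
      exact le_antisymm (not_lt.1 (key b hb a ha hab.symm)) (not_lt.1 (key a ha b hb hab))
  have h2 : S ⊆ T ∪ (Finset.Ico 1 H).biUnion fun h => S.filter fun k => k + h ∈ S := by
    intro k hk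
    by_cases hkT : k ∈ T
    · exact Finset.mem_union_left _ hkT
    · refine Finset.mem_union_right _ ?_
      simp only [hT, Finset.mem_filter, not_and, not_forall, not_not] at hkT
      obtain ⟨h, hh, hkh⟩ := hkT hk
      exact Finset.mem_biUnion.2 ⟨h, hh, Finset.mem_filter.2 ⟨hk, hkh⟩⟩
  calc S.card ≤ _ := Finset.card_le_card h2
    _ ≤ _ := Finset.card_union_le _ _
    _ ≤ _ := add_le_add h1 Finset.card_biUnion_le

/-- The iterated forward difference with the list of steps `hs`. -/
def iteratedDiff (u : ℕ → ℤ) (hs : List ℕ) : ℕ → ℤ :=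
  hs.foldl (fun v h => fun k => v (k + h) - v k) u

lemma iteratedDiff_cons (u : ℕ → ℤ) (h : ℕ) (hs : List ℕ) :
    iteratedDiff u (h :: hs) = iteratedDiff (fun k => u (k + h) - u k) hs := rfl

lemma card_filter_dvd_le_of_iteratedDiff {e : ℤ} {K : ℕ} {B : ℝ} (m : ℕ) :
    ∀ (H : ℕ), 1 ≤ H → H ^ 2 ^ m ≤ K → ∀ (u : ℕ → ℤ) (c : ℤ),
    (∀ hs : List ℕ, hs.length = m → (∀ h ∈ hs, 1 ≤ h ∧ h ≤ H ^ 2 ^ m) →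
      (((Finset.Ico K (2 * K)).filter fun k => e ∣ iteratedDiff u hs k -
        (if m = 0 then c else 0)).card : ℝ) ≤ B) →
    (((Finset.Ico K (2 * K)).filter fun k => e ∣ u k - c).card : ℝ) ≤
      m * (3 * K / H) + (H : ℝ) ^ (2 ^ m - 1) * B := by
  induction m with
  | zero =>
    intro H _ _ u c hB
    have := hB [] rfl (by simp)
    simpa [iteratedDiff] using this
  | succ m ih =>
    intro H hH hHK u c hB
    set S := (Finset.Ico K (2 * K)).filter fun k => e ∣ u k - c with hS
    have h1 := card_le_add_sum_card_shift hH (Finset.filter_subset _ _ : S ⊆ _)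
    have hHr : (1 : ℝ) ≤ H := by exact_mod_cast hH
    have hpow : (H ^ 2) ^ 2 ^ m = H ^ 2 ^ (m + 1) := by rw [← pow_mul, pow_succ' 2 m]
    have hHle : H ≤ H ^ 2 ^ (m + 1) := Nat.le_self_pow (by positivity) H
    have h2 : ∀ h ∈ Finset.Ico 1 H, ((S.filter fun k => k + h ∈ S).card : ℝ) ≤
        m * (3 * K / (H : ℝ) ^ 2) + (H : ℝ) ^ (2 * (2 ^ m - 1)) * B := by
      intro h hh
      have hh' := Finset.mem_Ico.1 hh
      have h3 := ih (H ^ 2) (Nat.one_le_pow _ _ hH) (hpow ▸ hHK) (fun k => u (k + h) - u k) 0 (by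
        intro hs hlen hhs
        have := hB (h :: hs) (by simp [hlen]) (by
          intro h' hmem
          rcases List.mem_cons.1 hmem with rfl | hmem
          · exact ⟨hh'.1, by lia⟩
          · exact hpow ▸ hhs h' hmem)
        simpa [iteratedDiff_cons] using this)
      have hcard : (S.filter fun k => k + h ∈ S).card ≤
          ((Finset.Ico K (2 * K)).filter fun k => e ∣ u (k + h) - u k - 0).card := by
        refine Finset.card_le_card fun k hk => ?_
        simp only [hS, Finset.mem_filter] at hk ⊢
        refine ⟨hk.1.1, ?_⟩
        have := dvd_sub hk.2.2 hk.1.2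
        simpa using this
      push_cast at h3
      rw [← pow_mul] at h3
      exact (Nat.cast_le.2 hcard).trans h3
    have hK : (H : ℝ) ≤ K := by exact_mod_cast hHle.trans hHK
    have h4 : ((2 * K / H : ℕ) : ℝ) + 1 ≤ 3 * K / H := by
      have : ((2 * K / H : ℕ) : ℝ) ≤ ((2 * K : ℕ) : ℝ) / H := Nat.cast_div_le
      have h5 : 1 ≤ (K : ℝ) / H := (one_le_div (by linarith)).2 hK
      push_cast at this
      have e1 : (2 * K : ℝ) / H = 2 * (K / H) := by ring
      have e2 : (3 * K : ℝ) / H = 3 * (K / H) := by ring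
      linarith
    have hnn : 0 ≤ m * (3 * K / (H : ℝ) ^ 2) + (H : ℝ) ^ (2 * (2 ^ m - 1)) * B ∨ H = 1 := by
      rcases Nat.eq_or_lt_of_le hH with h | h
      · exact Or.inr h.symm
      · exact Or.inl ((Nat.cast_nonneg _).trans (h2 1 (Finset.mem_Ico.2 ⟨le_rfl, h⟩)))
    have hB0 : 0 ≤ B := (Nat.cast_nonneg _).trans (hB (List.replicate (m + 1) 1) (by simp) (by
      intro h hh
      rw [List.eq_of_mem_replicate hh]
      exact ⟨le_rfl, Nat.one_le_pow _ _ hH⟩))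
    have h6 : ((∑ h ∈ Finset.Ico 1 H, (S.filter fun k => k + h ∈ S).card : ℕ) : ℝ) ≤
        H * (m * (3 * K / (H : ℝ) ^ 2) + (H : ℝ) ^ (2 * (2 ^ m - 1)) * B) := by
      push_cast
      refine (Finset.sum_le_card_nsmul _ _ _ h2).trans ?_
      rw [nsmul_eq_mul, Nat.card_Ico]
      gcongr
      lia
    have h7 : (S.card : ℝ) ≤ ((2 * K / H : ℕ) : ℝ) + 1 +
        ((∑ h ∈ Finset.Ico 1 H, (S.filter fun k => k + h ∈ S).card : ℕ) : ℝ) := by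
      exact_mod_cast h1
    have hexp : (H : ℝ) ^ (2 ^ (m + 1) - 1) = H * (H : ℝ) ^ (2 * (2 ^ m - 1)) := by
      rw [← pow_succ']
      congr 1
      have := Nat.one_le_two_pow (n := m)
      rw [pow_succ]
      lia
    have e3 : H * (m * (3 * K / (H : ℝ) ^ 2)) = m * (3 * K / H) := by
      field_simp
    rw [hexp]
    push_cast
    linarith

/-- The iterated forward difference of a real function, with the list of steps `hs`. -/
def iteratedDiffReal (f : ℝ → ℝ) : List ℕ → ℝ → ℝ
  | [], x => f x
  | h :: hs, x => iteratedDiffReal f hs (x + h) - iteratedDiffReal f hs x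

lemma iteratedDiffReal_sub (f : ℝ → ℝ) (h : ℕ) (hs : List ℕ) (x : ℝ) :
    iteratedDiffReal (fun y => f (y + h) - f y) hs x = iteratedDiffReal f (h :: hs) x := by
  induction hs generalizing x with
  | nil => rfl
  | cons g hs ih =>
    simp only [iteratedDiffReal] at ih ⊢
    rw [ih, ih, add_right_comm]
    ring

lemma hasDerivAt_iteratedDiffReal_rpow (a : ℝ) (hs : List ℕ) {x : ℝ} (hx : 0 < x) :
    HasDerivAt (iteratedDiffReal (fun y => y ^ a) hs)
      (a * iteratedDiffReal (fun y => y ^ (a - 1)) hs x) x := by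
  induction hs generalizing x with
  | nil => exact Real.hasDerivAt_rpow_const (Or.inl hx.ne')
  | cons h hs ih =>
    have h1 := (ih (x := x + h) (by positivity)).comp_add_const x (h : ℝ)
    have h2 := h1.sub (ih hx)
    rw [← mul_sub] at h2
    exact h2

lemma exists_iteratedDiffReal_rpow_eq (hs : List ℕ) (a : ℝ) {x : ℝ} (hx : 0 < x) :
    ∃ ξ, x ≤ ξ ∧ ξ ≤ x + (hs.sum : ℕ) ∧ iteratedDiffReal (fun y => y ^ a) hs x =
      (hs.prod : ℕ) * (∏ i ∈ Finset.range hs.length, (a - i)) * ξ ^ (a - hs.length) := by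
  induction hs generalizing a x with
  | nil => exact ⟨x, le_rfl, by simp, by simp [iteratedDiffReal]⟩
  | cons h hs ih =>
    have hmvt : ∃ η, x ≤ η ∧ η ≤ x + h ∧ iteratedDiffReal (fun y => y ^ a) (h :: hs) x =
        h * (a * iteratedDiffReal (fun y => y ^ (a - 1)) hs η) := by
      rcases Nat.eq_zero_or_pos h with rfl | hpos
      · exact ⟨x, le_rfl, by simp, by simp [iteratedDiffReal]⟩
      · have hlt : x < x + h := by
          have : (0 : ℝ) < h := by exact_mod_cast hpos
          linarith
        obtain ⟨η, hη, he⟩ := exists_hasDerivAt_eq_slope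
          (iteratedDiffReal (fun y => y ^ a) hs)
          (fun y => a * iteratedDiffReal (fun y => y ^ (a - 1)) hs y) hlt
          (fun y hy => (hasDerivAt_iteratedDiffReal_rpow a hs
            (hx.trans_le hy.1)).continuousAt.continuousWithinAt)
          (fun y hy => hasDerivAt_iteratedDiffReal_rpow a hs (hx.trans hy.1))
        refine ⟨η, hη.1.le, hη.2.le, ?_⟩
        have : (h : ℝ) ≠ 0 := by exact_mod_cast hpos.ne'
        rw [he, add_sub_cancel_left]
        simp only [iteratedDiffReal]
        field_simp
    obtain ⟨η, h1, h2, h3⟩ := hmvt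
    obtain ⟨ξ, h4, h5, h6⟩ := ih (a - 1) (hx.trans_le h1)
    refine ⟨ξ, h1.trans h4, ?_, ?_⟩
    · rw [List.sum_cons, Nat.cast_add]; linarith
    · rw [h3, h6, List.prod_cons, List.length_cons, Finset.prod_range_succ']
      have e1 : a - 1 - (hs.length : ℝ) = a - ((hs.length + 1 : ℕ) : ℝ) := by push_cast; ring
      have e2 : ∏ i ∈ Finset.range hs.length, (a - 1 - (i : ℝ)) =
          ∏ i ∈ Finset.range hs.length, (a - ((i + 1 : ℕ) : ℝ)) :=
        Finset.prod_congr rfl fun i _ => by push_cast; ring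
      rw [e1, e2, Nat.cast_mul, Nat.cast_zero, sub_zero]
      ring

lemma abs_iteratedDiff_sub_le (hs : List ℕ) (u : ℕ → ℤ) (f : ℝ → ℝ) {M : ℝ}
    (huf : ∀ k : ℕ, |(u k : ℝ) - f k| ≤ M) (k : ℕ) :
    |(iteratedDiff u hs k : ℝ) - iteratedDiffReal f hs k| ≤ 2 ^ hs.length * M := by
  induction hs generalizing u f M with
  | nil => simpa [iteratedDiff, iteratedDiffReal] using huf k
  | cons h hs ih =>
    rw [iteratedDiff_cons, ← iteratedDiffReal_sub, List.length_cons, pow_succ, mul_assoc]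
    refine ih _ _ fun j => ?_
    have h1 := abs_le.1 (huf (j + h))
    have h2 := abs_le.1 (huf j)
    push_cast at h1 ⊢
    rw [abs_le]
    constructor <;> linarith

lemma card_filter_abs_sub_mul_le {G : ℕ → ℝ} {K e : ℕ} {a b M : ℝ} (he : 1 ≤ e)
    (ha : 0 < a) (hM : 0 ≤ M) (hb : 0 ≤ b)
    (hG : ∀ k ∈ Finset.Ico K (2 * K), a ≤ G (k + 1) - G k ∧ G (k + 1) - G k ≤ b)
    {v : ℕ → ℤ} (hv : ∀ k, |(v k : ℝ) - G k| ≤ M) :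
    (((Finset.Ico K (2 * K)).filter fun k => (e : ℤ) ∣ v k).card : ℝ) ≤
      ((b * K + 2 * M) / e + 1) * (2 * M / a + 1) := by
  have hdiff : ∀ d k : ℕ, K ≤ k → k + d ≤ 2 * K →
      a * d ≤ G (k + d) - G k ∧ G (k + d) - G k ≤ b * d := by
    intro d
    induction d with
    | zero => intro k _ _; simp
    | succ d ih =>
      intro k h1 h2
      have h3 := ih k h1 (by lia)
      have h4 := hG (k + d) (Finset.mem_Ico.2 ⟨by lia, by lia⟩)
      rw [← add_assoc]
      push_cast
      constructor <;> linarith [h3.1, h3.2, h4.1, h4.2]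
  set S := (Finset.Ico K (2 * K)).filter fun k => (e : ℤ) ∣ v k with hS
  have her : (0 : ℝ) < e := by exact_mod_cast he
  have hcardInt : ∀ x y : ℝ, x ≤ y → ((Finset.Icc ⌈x⌉ ⌊y⌋).card : ℝ) ≤ y - x + 1 := by
    intro x y hxy
    rw [Int.card_Icc]
    have h1 := Int.floor_le y
    have h2 := Int.le_ceil x
    have : ((⌊y⌋ + 1 - ⌈x⌉ : ℤ) : ℝ) ≤ y - x + 1 := by push_cast; linarith
    rcases le_total 0 (⌊y⌋ + 1 - ⌈x⌉) with h | h
    · have e1 : (((⌊y⌋ + 1 - ⌈x⌉).toNat : ℤ)) = ⌊y⌋ + 1 - ⌈x⌉ := Int.toNat_of_nonneg h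
      have e2 : (((⌊y⌋ + 1 - ⌈x⌉).toNat : ℕ) : ℝ) = ((⌊y⌋ + 1 - ⌈x⌉ : ℤ) : ℝ) := by
        exact_mod_cast congrArg (Int.cast : ℤ → ℝ) e1
      rw [e2]; exact this
    · rw [Int.toNat_of_nonpos h]
      simp only [Nat.cast_zero]
      linarith
  set J := Finset.Icc ⌈(G K - M) / e⌉ ⌊(G K + b * K + M) / e⌋ with hJ
  have hJcard : (J.card : ℝ) ≤ (b * K + 2 * M) / e + 1 := by
    have := hcardInt ((G K - M) / e) ((G K + b * K + M) / e)
      (by gcongr; nlinarith [mul_nonneg hb (Nat.cast_nonneg (α := ℝ) K)])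
    refine this.trans (le_of_eq ?_)
    ring
  have hmaps : ∀ k ∈ S, v k / e ∈ J := by
    intro k hk
    rw [hS, Finset.mem_filter, Finset.mem_Ico] at hk
    obtain ⟨d, rfl⟩ := Nat.exists_eq_add_of_le hk.1.1
    have h1 := hdiff d K le_rfl (by lia)
    have h2 := abs_le.1 (hv (K + d))
    obtain ⟨j, hj⟩ := hk.2
    have hj' : (v (K + d) : ℝ) = e * j := by rw [hj]; push_cast; ring
    have hjd : v (K + d) / e = j := by
      rw [hj]; exact Int.mul_ediv_cancel_left _ (by lia)
    have hdK : (d : ℝ) ≤ K := by exact_mod_cast (by lia : d ≤ K)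
    have hbd : b * d ≤ b * K := mul_le_mul_of_nonneg_left hdK hb
    have had : 0 ≤ a * d := by positivity
    rw [hjd, hJ, Finset.mem_Icc, Int.ceil_le, Int.le_floor, div_le_iff₀ her, le_div_iff₀ her]
    constructor <;> linarith
  have hfib : ∀ j ∈ J, ((S.filter fun k => v k / e = j).card : ℝ) ≤ 2 * M / a + 1 := by
    intro j _
    set F := S.filter fun k => v k / e = j with hF
    rcases F.eq_empty_or_nonempty with h | hne
    · rw [h]; simp; positivity
    · have hsub : F ⊆ Finset.Icc (F.min' hne) (F.min' hne + ⌊2 * M / a⌋₊) := by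
        intro k hk
        have hm := F.min'_mem hne
        have hle := F.min'_le k hk
        set k₀ := F.min' hne
        rw [Finset.mem_Icc]
        refine ⟨hle, ?_⟩
        obtain ⟨d, rfl⟩ := Nat.exists_eq_add_of_le hle
        simp only [hF, hS, Finset.mem_filter, Finset.mem_Ico] at hk hm
        have h1 := (hdiff d k₀ hm.1.1.1 (by lia)).1
        have e1 : v (k₀ + d) = v k₀ := by
          rw [← Int.ediv_mul_cancel hk.1.2, ← Int.ediv_mul_cancel hm.1.2, hk.2, hm.2]
        have h2 := abs_le.1 (hv (k₀ + d))
        have h3 := abs_le.1 (hv k₀)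
        rw [e1] at h2
        have : (d : ℝ) ≤ 2 * M / a := by
          rw [le_div_iff₀ ha]; linarith
        have := Nat.le_floor this
        lia
      have hc := Finset.card_le_card hsub
      have : F.card ≤ ⌊2 * M / a⌋₊ + 1 := hc.trans (by rw [Nat.card_Icc]; lia)
      have h3 : (F.card : ℝ) ≤ (⌊2 * M / a⌋₊ : ℝ) + 1 := by exact_mod_cast this
      have h4 := Nat.floor_le (a := 2 * M / a) (by positivity)
      linarith
  rw [Finset.card_eq_sum_card_fiberwise hmaps]
  push_cast
  refine (Finset.sum_le_card_nsmul _ _ _ hfib).trans ?_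
  rw [nsmul_eq_mul]
  gcongr

lemma exists_card_filter_iteratedDiff_floor_rpow_le {r : ℝ} {m : ℕ} {θ : ℝ}
    (hmr : (m : ℝ) < r) (hθ : θ = m + 1 - r) (hθ0 : 0 < θ) :
    ∃ C > (0 : ℝ), ∀ (K e Z : ℕ), 1 ≤ K → 1 ≤ e → Z ≤ K → ∀ hs : List ℕ, hs.length = m →
      (∀ h ∈ hs, 1 ≤ h ∧ h ≤ Z) →
      (((Finset.Ico K (2 * K)).filter fun k =>
        (e : ℤ) ∣ iteratedDiff (fun k : ℕ => (⌊(k : ℝ) ^ r⌋₊ : ℤ)) hs k).card : ℝ) ≤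
      C * ((Z : ℝ) ^ m * K / e + (K : ℝ) ^ θ) := by
  set c := ∏ i ∈ Finset.range (m + 1), (r - i) with hc
  have hc0 : 0 < c := by
    refine Finset.prod_pos fun i hi => ?_
    have : (i : ℝ) ≤ m := by exact_mod_cast Nat.lt_succ_iff.1 (Finset.mem_range.1 hi)
    linarith
  set w : ℝ := ((m : ℝ) + 3) ^ θ with hw
  have hw0 : 0 < w := by positivity
  set M : ℝ := 2 ^ m with hM
  have hM0 : 0 < M := by positivity
  set q := 2 * M * w / c with hq
  have hq0 : 0 < q := by positivity
  refine ⟨c * q + c + (2 * M * q + 2 * M + q + 1), by positivity, ?_⟩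
  intro K e Z hK he hZK hs hlen hhs
  set D : ℝ := ((hs.prod : ℕ) : ℝ) with hD
  have hD1 : 1 ≤ D := by
    have : 1 ≤ hs.prod := Nat.one_le_iff_ne_zero.2 fun h0 => by
      have := hhs 0 (List.prod_eq_zero_iff.1 h0)
      lia
    exact Nat.one_le_cast.2 this
  have hDZ : D ≤ (Z : ℝ) ^ m := by
    have := List.prod_le_pow_card hs Z fun h hh => (hhs h hh).2
    rw [hlen] at this
    exact (Nat.cast_le.2 this).trans_eq (Nat.cast_pow Z m)
  have hsum : hs.sum ≤ m * K := by
    have := List.sum_le_card_nsmul hs Z fun h hh => (hhs h hh).2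
    rw [hlen, smul_eq_mul] at this
    exact this.trans (Nat.mul_le_mul_left _ hZK)
  have hKr : (1 : ℝ) ≤ K := by exact_mod_cast hK
  have her : (1 : ℝ) ≤ e := by exact_mod_cast he
  set T : ℝ := (K : ℝ) ^ θ with hT
  have hT1 : 1 ≤ T := Real.one_le_rpow hKr hθ0.le
  have hinc : ∀ k ∈ Finset.Ico K (2 * K),
      D * c / (w * T) ≤ iteratedDiffReal (fun y => y ^ r) hs ((k + 1 : ℕ) : ℝ) -
        iteratedDiffReal (fun y => y ^ r) hs k ∧
      iteratedDiffReal (fun y => y ^ r) hs ((k + 1 : ℕ) : ℝ) -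
        iteratedDiffReal (fun y => y ^ r) hs k ≤ D * c / T := by
    intro k hk
    rw [Finset.mem_Ico] at hk
    have hkr : (K : ℝ) ≤ k := by exact_mod_cast hk.1
    have hkr2 : (k : ℝ) ≤ 2 * K := by exact_mod_cast hk.2.le
    obtain ⟨ξ, h1, h2, h3⟩ := exists_iteratedDiffReal_rpow_eq (1 :: hs) r
      (x := k) (by linarith)
    have e1 : iteratedDiffReal (fun y => y ^ r) hs ((k + 1 : ℕ) : ℝ) -
        iteratedDiffReal (fun y => y ^ r) hs k =
        iteratedDiffReal (fun y => y ^ r) (1 :: hs) k := by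
      simp [iteratedDiffReal]
    rw [List.length_cons, hlen, List.prod_cons, one_mul, ← hc] at h3
    have e2 : r - ((m + 1 : ℕ) : ℝ) = -θ := by rw [hθ]; push_cast; ring
    have hξ0 : 0 < ξ := by linarith
    have hs2 : ((hs.sum : ℕ) : ℝ) ≤ m * K := by exact_mod_cast hsum
    have hξ2 : ξ ≤ (m + 3) * K := by
      rw [List.sum_cons, Nat.cast_add] at h2
      push_cast at h2 hs2
      linarith
    rw [e1, h3, e2, Real.rpow_neg hξ0.le]
    have h4 : T ≤ ξ ^ θ := Real.rpow_le_rpow (by linarith) (by linarith) hθ0.le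
    have h5 : ξ ^ θ ≤ w * T := by
      rw [hw, hT, ← Real.mul_rpow (by positivity) (by positivity)]
      exact Real.rpow_le_rpow hξ0.le hξ2 hθ0.le
    rw [← div_eq_mul_inv]
    constructor
    · gcongr
    · gcongr
  have hv : ∀ k : ℕ, |(iteratedDiff (fun k : ℕ => (⌊(k : ℝ) ^ r⌋₊ : ℤ)) hs k : ℝ) -
      iteratedDiffReal (fun y => y ^ r) hs k| ≤ M := by
    intro k
    have := abs_iteratedDiff_sub_le hs (fun k : ℕ => (⌊(k : ℝ) ^ r⌋₊ : ℤ)) (fun y => y ^ r)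
      (M := 1) (fun j => by
        have h1 := Nat.floor_le (a := (j : ℝ) ^ r) (by positivity)
        have h2 := Nat.lt_floor_add_one ((j : ℝ) ^ r)
        rw [abs_le, Int.cast_natCast]
        constructor <;> linarith) k
    rwa [hlen, mul_one] at this
  have := card_filter_abs_sub_mul_le (e := e) he (a := D * c / (w * T)) (b := D * c / T)
    (by positivity) hM0.le (by positivity) hinc hv
  refine this.trans ?_
  have e3 : 2 * M / (D * c / (w * T)) = q * T / D := by
    rw [hq]; field_simp
  rw [e3]
  have e4 : ((D * c / T * K + 2 * M) / e + 1) * (q * T / D + 1) =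
      c * q * (K / e) + c * (D * K / e) / T + 2 * M * q * T / D / e + 2 * M / e + q * T / D + 1 := by
    field_simp
    ring
  rw [e4]
  have hKe : (K : ℝ) / e ≤ (Z : ℝ) ^ m * K / e := by
    gcongr
    exact le_mul_of_one_le_left (by linarith) (hD1.trans hDZ)
  have t1 : c * q * (K / e) ≤ c * q * ((Z : ℝ) ^ m * K / e) := by gcongr
  have t2 : c * (D * K / e) / T ≤ c * ((Z : ℝ) ^ m * K / e) := by
    refine (div_le_self (by positivity) hT1).trans ?_
    gcongr
  have t3 : 2 * M * q * T / D / e ≤ 2 * M * q * T :=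
    (div_le_self (by positivity) her).trans (div_le_self (by positivity) hD1)
  have t4 : 2 * M / e ≤ 2 * M * T :=
    (div_le_self (by positivity) her).trans (le_mul_of_one_le_right (by positivity) hT1)
  have t5 : q * T / D ≤ q * T := div_le_self (by positivity) hD1
  have hX0 : 0 ≤ (Z : ℝ) ^ m * K / e := by positivity
  have : 0 ≤ (2 * M * q + 2 * M + q + 1) * ((Z : ℝ) ^ m * K / e) + (c * q + c) * T := by positivity
  linarith

lemma exists_card_filter_floor_rpow_le {r : ℝ} {m : ℕ} {θ : ℝ}
    (hm : 1 ≤ m) (hmr : (m : ℝ) < r) (hθ : θ = m + 1 - r) (hθ0 : 0 < θ) :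
    ∃ C > (0 : ℝ), ∀ (H K e c : ℕ), 1 ≤ H → H ^ 2 ^ m ≤ K → 1 ≤ e →
      (((Finset.Ico K (2 * K)).filter fun k : ℕ => ⌊(k : ℝ) ^ r⌋₊ ≡ c [MOD e]).card : ℝ) ≤
      C * K * (1 / H + (H : ℝ) ^ ((m + 1) * 2 ^ m) * (1 / e + (K : ℝ) ^ (θ - 1))) := by
  obtain ⟨C, hC, hbd⟩ := exists_card_filter_iteratedDiff_floor_rpow_le hmr hθ hθ0
  refine ⟨3 * m + C, by positivity, ?_⟩
  intro H K e c hH hHK he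
  have hK : 1 ≤ K := (Nat.one_le_pow _ _ hH).trans hHK
  have hKr : (1 : ℝ) ≤ K := by exact_mod_cast hK
  have hHr : (1 : ℝ) ≤ H := by exact_mod_cast hH
  have h1 := card_filter_dvd_le_of_iteratedDiff (e := e) (K := K)
    (B := C * (((H ^ 2 ^ m : ℕ) : ℝ) ^ m * K / e + (K : ℝ) ^ θ)) m H hH hHK
    (fun k : ℕ => (⌊(k : ℝ) ^ r⌋₊ : ℤ)) c (by
      intro hs hlen hhs
      have := hbd K e (H ^ 2 ^ m) hK he hHK hs hlen hhs
      simpa only [if_neg (show m ≠ 0 by lia), sub_zero] using this)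
  have h2 : (Finset.Ico K (2 * K)).filter (fun k : ℕ => ⌊(k : ℝ) ^ r⌋₊ ≡ c [MOD e]) =
      (Finset.Ico K (2 * K)).filter fun k : ℕ => (e : ℤ) ∣ (⌊(k : ℝ) ^ r⌋₊ : ℤ) - c := by
    refine Finset.filter_congr fun k _ => ?_
    rw [Nat.ModEq.comm, Nat.modEq_iff_dvd]
  rw [h2]
  refine h1.trans ?_
  push_cast
  rw [← pow_mul]
  have e1 : (K : ℝ) ^ θ = K * (K : ℝ) ^ (θ - 1) := by
    rw [Real.rpow_sub_one (by linarith)]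
    field_simp
  rw [e1]
  set Y := (K : ℝ) ^ (θ - 1) with hY
  have hY0 : 0 ≤ Y := by positivity
  have b1 : (H : ℝ) ^ (2 ^ m - 1) * (H : ℝ) ^ (2 ^ m * m) ≤ (H : ℝ) ^ ((m + 1) * 2 ^ m) := by
    rw [← pow_add]
    refine pow_le_pow_right₀ hHr ?_
    have : (m + 1) * 2 ^ m = 2 ^ m + 2 ^ m * m := by ring
    lia
  have b2 : (H : ℝ) ^ (2 ^ m - 1) ≤ (H : ℝ) ^ ((m + 1) * 2 ^ m) := by
    refine pow_le_pow_right₀ hHr ?_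
    have : (m + 1) * 2 ^ m = 2 ^ m + 2 ^ m * m := by ring
    lia
  set P := (H : ℝ) ^ ((m + 1) * 2 ^ m) with hP
  have hP0 : 0 ≤ P := by positivity
  have c1 : (H : ℝ) ^ (2 ^ m - 1) * (C * ((H : ℝ) ^ (2 ^ m * m) * K / e + K * Y)) ≤
      C * K * (P * (1 / e + Y)) := by
    calc _ = C * K * ((H : ℝ) ^ (2 ^ m - 1) * (H : ℝ) ^ (2 ^ m * m) * (1 / e) +
          (H : ℝ) ^ (2 ^ m - 1) * Y) := by ring
      _ ≤ C * K * (P * (1 / e) + P * Y) := by gcongr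
      _ = _ := by ring
  have c2 : (m : ℝ) * (3 * K / H) = 3 * m * K * (1 / H) := by ring
  have c3 : 0 ≤ 3 * m * K * (P * (1 / e + Y)) + C * K * (1 / H) := by positivity
  rw [c2]
  linarith

/-- Power-saving bound for the number of `k` in a dyadic interval with `⌊k ^ r⌋` in a fixed
residue class, `r` not an integer. -/
lemma exists_card_filter_floor_rpow_modEq_le {r : ℝ} (hr : 1 < r) (hri : ∀ m : ℤ, r ≠ m) :
    ∃ C > (0 : ℝ), ∃ δ > (0 : ℝ), ∀ (K e c : ℕ), 1 ≤ K → 1 ≤ e →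
      (((Finset.Ico K (2 * K)).filter fun k : ℕ => ⌊(k : ℝ) ^ r⌋₊ ≡ c [MOD e]).card : ℝ) ≤
      C * K * ((e : ℝ) ^ (-δ) + (K : ℝ) ^ (-δ)) := by
  set m := ⌊r⌋₊ with hm
  have hm1 : 1 ≤ m := Nat.le_floor (by exact_mod_cast hr.le)
  have hmr : (m : ℝ) < r := lt_of_le_of_ne (Nat.floor_le (by linarith)) fun h =>
    hri m (by rw [← h]; simp)
  have hmr2 : r < m + 1 := Nat.lt_floor_add_one r
  obtain ⟨C, hC, hbd⟩ := exists_card_filter_floor_rpow_le hm1 hmr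
    (θ := m + 1 - r) rfl (by linarith)
  set φ : ℝ := 1 - (m + 1 - r) with hφ
  have hφ0 : 0 < φ := by rw [hφ]; linarith
  have hφ1 : φ ≤ 1 := by rw [hφ]; linarith
  set Q : ℕ := (m + 1) * 2 ^ m with hQ
  set η : ℝ := 1 / (Q + 1) with hη
  have hη0 : 0 < η := by positivity
  have hηQ : η * (Q + 1) = 1 := by rw [hη]; field_simp
  refine ⟨6 * C, by positivity, φ * η, by positivity, ?_⟩
  intro K e c hK he
  have hKr : (1 : ℝ) ≤ K := by exact_mod_cast hK
  have her : (1 : ℝ) ≤ e := by exact_mod_cast he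
  set Y : ℝ := min e ((K : ℝ) ^ φ) with hY
  have hYe : Y ≤ e := min_le_left _ _
  have hYK : Y ≤ (K : ℝ) ^ φ := min_le_right _ _
  have hY1 : 1 ≤ Y := le_min her (Real.one_le_rpow hKr hφ0.le)
  have hYη : 1 ≤ Y ^ η := Real.one_le_rpow hY1 hη0.le
  set H := ⌊Y ^ η⌋₊ with hH
  have hH1 : 1 ≤ H := Nat.le_floor (by exact_mod_cast hYη)
  have hHle : (H : ℝ) ≤ Y ^ η := Nat.floor_le (by linarith)
  have hHge : Y ^ η ≤ 2 * H := by
    have := Nat.lt_floor_add_one (Y ^ η)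
    have : (1 : ℝ) ≤ H := by exact_mod_cast hH1
    linarith
  have hHr : (1 : ℝ) ≤ H := by exact_mod_cast hH1
  have hHQ : (H : ℝ) ^ (Q + 1) ≤ Y := by
    calc (H : ℝ) ^ (Q + 1) ≤ (Y ^ η) ^ (Q + 1) := by gcongr
      _ = Y := by
        rw [← Real.rpow_natCast, ← Real.rpow_mul (by linarith)]
        push_cast
        rw [hηQ, Real.rpow_one]
  have hHK : H ^ 2 ^ m ≤ K := by
    have h1 : (H : ℝ) ^ 2 ^ m ≤ (H : ℝ) ^ (Q + 1) := by
      refine pow_le_pow_right₀ hHr ?_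
      have : (m + 1) * 2 ^ m = 2 ^ m + m * 2 ^ m := by ring
      lia
    have h2 : (K : ℝ) ^ φ ≤ K := by
      calc (K : ℝ) ^ φ ≤ (K : ℝ) ^ (1 : ℝ) := Real.rpow_le_rpow_of_exponent_le hKr hφ1
        _ = K := Real.rpow_one _
    exact_mod_cast h1.trans (hHQ.trans (hYK.trans h2))
  refine (hbd H K e c hH1 hHK he).trans ?_
  have hY0 : 0 < Y := by linarith
  have hYn : Y ^ (-η) = 1 / Y ^ η := by rw [Real.rpow_neg hY0.le, one_div]
  have b1 : 1 / (H : ℝ) ≤ 2 * Y ^ (-η) := by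
    rw [hYn, ← mul_div_assoc, mul_one, div_le_div_iff₀ (by linarith) (by linarith)]
    linarith
  have b2 : (K : ℝ) ^ ((m + 1 - r) - 1) ≤ 1 / Y := by
    have : (m + 1 - r) - 1 = -φ := by rw [hφ]; ring
    rw [this, Real.rpow_neg (by linarith), ← one_div]
    exact one_div_le_one_div_of_le hY0 hYK
  have b3 : 1 / (e : ℝ) ≤ 1 / Y := one_div_le_one_div_of_le hY0 hYe
  have b4 : (H : ℝ) ^ Q * (1 / Y) ≤ 1 / H := by
    rw [mul_one_div, div_le_div_iff₀ hY0 (by linarith), ← pow_succ, one_mul]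
    exact hHQ
  have b5 : (H : ℝ) ^ Q * (1 / e + (K : ℝ) ^ ((m + 1 - r) - 1)) ≤ 2 * (2 * Y ^ (-η)) := by
    calc _ ≤ (H : ℝ) ^ Q * (1 / Y + 1 / Y) := by gcongr
      _ = 2 * ((H : ℝ) ^ Q * (1 / Y)) := by ring
      _ ≤ _ := by linarith
  have b6 : Y ^ (-η) ≤ (e : ℝ) ^ (-(φ * η)) + (K : ℝ) ^ (-(φ * η)) := by
    rcases min_choice (e : ℝ) ((K : ℝ) ^ φ) with h | h
    · rw [hY, h]
      have : (e : ℝ) ^ (-η) ≤ (e : ℝ) ^ (-(φ * η)) :=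
        Real.rpow_le_rpow_of_exponent_le her (by nlinarith)
      have : 0 ≤ (K : ℝ) ^ (-(φ * η)) := by positivity
      linarith
    · rw [hY, h, ← Real.rpow_mul (by linarith), mul_neg]
      have : 0 ≤ (e : ℝ) ^ (-(φ * η)) := by positivity
      linarith
  calc C * K * (1 / H + (H : ℝ) ^ Q * (1 / e + (K : ℝ) ^ ((m + 1 - r) - 1)))
      ≤ C * K * (2 * Y ^ (-η) + 2 * (2 * Y ^ (-η))) := by gcongr
    _ = 6 * C * K * Y ^ (-η) := by ring
    _ ≤ 6 * C * K * ((e : ℝ) ^ (-(φ * η)) + (K : ℝ) ^ (-(φ * η))) := by gcongr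

lemma prod_one_add_inv_le_exp (S : Finset ℕ) :
    ∏ p ∈ S, (1 + 1 / (p : ℝ)) ≤ Real.exp (∑ p ∈ S, 1 / (p : ℝ)) := by
  rw [Real.exp_sum]
  refine Finset.prod_le_prod (fun _ _ => by positivity) fun p _ => ?_
  rw [add_comm]
  exact Real.add_one_le_exp _

lemma card_primeFactors_le {h L : ℕ} (hh : h ≠ 0) (hL : h < 2 ^ L) : h.primeFactors.card ≤ L := by
  have h1 : 2 ^ h.primeFactors.card ≤ ∏ p ∈ h.primeFactors, p :=
    Finset.pow_card_le_prod _ _ _ fun p hp => (Nat.prime_of_mem_primeFactors hp).two_le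
  have h2 := Nat.le_of_dvd (Nat.pos_of_ne_zero hh) (Nat.prod_primeFactors_dvd h)
  exact (Nat.pow_lt_pow_iff_right (by norm_num : 1 < 2)).1 ((h1.trans h2).trans_lt hL) |>.le

lemma mul_card_primes_dyadic_le (n : ℕ) :
    n * ((Finset.Ico (2 ^ n) (2 ^ (n + 1))).filter Nat.Prime).card ≤ 4 * 2 ^ n := by
  have h1 : (2 ^ n) ^ ((Finset.Ico (2 ^ n) (2 ^ (n + 1))).filter Nat.Prime).card ≤
      ∏ p ∈ (Finset.Ico (2 ^ n) (2 ^ (n + 1))).filter Nat.Prime, p :=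
    Finset.pow_card_le_prod _ _ _ fun p hp =>
      (Finset.mem_Ico.1 (Finset.mem_filter.1 hp).1).1
  have h2 : ∏ p ∈ (Finset.Ico (2 ^ n) (2 ^ (n + 1))).filter Nat.Prime, p ≤
      primorial (2 ^ (n + 1)) := by
    refine Nat.le_of_dvd (primorial_pos _) (Finset.prod_dvd_prod_of_subset _ _ _ fun p hp => ?_)
    simp only [Finset.mem_filter, Finset.mem_Ico, Finset.mem_range] at hp ⊢
    exact ⟨by lia, hp.2⟩
  have h3 := (h1.trans h2).trans (primorial_le_four_pow _)
  rw [← pow_mul, (by norm_num : 4 = 2 ^ 2), ← pow_mul] at h3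
  have := (Nat.pow_le_pow_iff_right (by norm_num : 1 < 2)).1 h3
  rw [pow_succ] at this
  lia

lemma exists_prod_primes_one_add_inv_le {ε : ℝ} (hε : 0 < ε) :
    ∃ C > (0 : ℝ), ∀ p : ℕ, 1 ≤ p →
      ∏ q ∈ (Finset.range p).filter Nat.Prime, (1 + 1 / (q : ℝ)) ≤ C * (p : ℝ) ^ ε := by
  set F : ℕ → ℝ := fun n => ∏ q ∈ (Finset.range n).filter Nat.Prime, (1 + 1 / (q : ℝ)) with hF
  have hone : ∀ q : ℕ, (1 : ℝ) ≤ 1 + 1 / (q : ℝ) := fun q => by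
    have : (0 : ℝ) ≤ 1 / q := by positivity
    linarith
  have hmono : Monotone F := fun a b hab =>
    Finset.prod_le_prod_of_subset_of_one_le
      (Finset.filter_subset_filter _ (Finset.range_mono hab))
      (fun q _ => zero_le_one.trans (hone q)) (fun q _ _ => hone q)
  have hF1 : ∀ n, 1 ≤ F n := fun n => by
    have : ∏ q ∈ (Finset.range n).filter Nat.Prime, (1 : ℝ) ≤ F n :=
      Finset.prod_le_prod (fun _ _ => zero_le_one) fun q _ => hone q
    simpa using this
  have hstep : ∀ n : ℕ, 1 ≤ n → F (2 ^ (n + 1)) ≤ F (2 ^ n) * Real.exp (4 / n) := by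
    intro n hn
    have hle : 2 ^ n ≤ 2 ^ (n + 1) := Nat.pow_le_pow_right (by norm_num) (by lia)
    have e : (Finset.range (2 ^ (n + 1))).filter Nat.Prime = (Finset.range (2 ^ n)).filter Nat.Prime ∪
        (Finset.Ico (2 ^ n) (2 ^ (n + 1))).filter Nat.Prime := by
      rw [← Finset.filter_union, Finset.range_eq_Ico, Finset.range_eq_Ico,
        Finset.Ico_union_Ico_eq_Ico (Nat.zero_le _) hle]
    have hd : Disjoint ((Finset.range (2 ^ n)).filter Nat.Prime)
        ((Finset.Ico (2 ^ n) (2 ^ (n + 1))).filter Nat.Prime) := by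
      refine Finset.disjoint_filter_filter ?_
      rw [Finset.range_eq_Ico]
      exact Finset.Ico_disjoint_Ico_consecutive _ _ _
    simp only [hF]
    rw [e, Finset.prod_union hd]
    refine mul_le_mul_of_nonneg_left ((prod_one_add_inv_le_exp _).trans
      (Real.exp_le_exp.2 ?_)) (by positivity)
    have h1 : ∑ q ∈ (Finset.Ico (2 ^ n) (2 ^ (n + 1))).filter Nat.Prime, 1 / (q : ℝ) ≤
        ((Finset.Ico (2 ^ n) (2 ^ (n + 1))).filter Nat.Prime).card • (1 / (2 : ℝ) ^ n) := by
      refine Finset.sum_le_card_nsmul _ _ _ fun q hq => ?_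
      have := (Finset.mem_Ico.1 (Finset.mem_filter.1 hq).1).1
      have h2 : (2 : ℝ) ^ n ≤ q := by exact_mod_cast this
      exact one_div_le_one_div_of_le (by positivity) h2
    refine h1.trans ?_
    have h2 : (n : ℝ) * ((Finset.Ico (2 ^ n) (2 ^ (n + 1))).filter Nat.Prime).card ≤
        4 * 2 ^ n := by exact_mod_cast mul_card_primes_dyadic_le n
    have hn0 : (0 : ℝ) < n := by exact_mod_cast hn
    rw [nsmul_eq_mul, mul_one_div, div_le_div_iff₀ (by positivity) hn0]
    linarith
  obtain ⟨n₀, hn₀⟩ : ∃ n₀ : ℕ, n₀ = ⌈4 / (ε * Real.log 2)⌉₊ + 1 := ⟨_, rfl⟩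
  have hl2 : 0 < Real.log 2 := Real.log_pos (by norm_num)
  have h2ε : (1 : ℝ) ≤ 2 ^ ε := Real.one_le_rpow (by norm_num) hε.le
  have hind : ∀ n : ℕ, F (2 ^ n) ≤ F (2 ^ n₀) * ((2 : ℝ) ^ ε) ^ n := by
    intro n
    rcases le_total n n₀ with h | h
    · refine (hmono (Nat.pow_le_pow_right (by norm_num) h)).trans ?_
      exact le_mul_of_one_le_right (zero_le_one.trans (hF1 _)) (one_le_pow₀ h2ε)
    · induction n, h using Nat.le_induction with
      | base => exact le_mul_of_one_le_right (zero_le_one.trans (hF1 _)) (one_le_pow₀ h2ε)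
      | succ n hn ih =>
        have hn1 : 1 ≤ n := by lia
        refine (hstep n hn1).trans ?_
        rw [pow_succ, ← mul_assoc]
        refine mul_le_mul ih ?_ (Real.exp_pos _).le
          (mul_nonneg (zero_le_one.trans (hF1 _)) (by positivity))
        rw [Real.rpow_def_of_pos (by norm_num), Real.exp_le_exp]
        have hn0 : (0 : ℝ) < n := by exact_mod_cast hn1
        have h3 : 4 / (ε * Real.log 2) ≤ n := by
          refine (Nat.le_ceil _).trans ?_
          exact_mod_cast (by lia : ⌈4 / (ε * Real.log 2)⌉₊ ≤ n)
        rw [div_le_iff₀ (by positivity)] at h3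
        rw [div_le_iff₀ hn0]
        linarith
  refine ⟨F (2 ^ n₀) * 2 ^ ε, mul_pos (zero_lt_one.trans_le (hF1 _)) (by positivity), ?_⟩
  intro p hp
  have hlt : p < 2 ^ (Nat.log 2 p + 1) := Nat.lt_pow_succ_log_self (by norm_num) p
  have hle : ((2 ^ Nat.log 2 p : ℕ) : ℝ) ≤ p := by
    exact_mod_cast Nat.pow_log_le_self 2 (by lia : p ≠ 0)
  refine (hmono hlt.le).trans ((hind _).trans ?_)
  rw [pow_succ', ← mul_assoc]
  refine mul_le_mul_of_nonneg_left ?_ (mul_nonneg (zero_le_one.trans (hF1 _)) (by positivity))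
  rw [← Real.rpow_natCast, ← Real.rpow_mul (by norm_num), mul_comm, Real.rpow_mul (by norm_num),
    Real.rpow_natCast]
  push_cast at hle
  exact Real.rpow_le_rpow (by positivity) hle hε.le

lemma sum_inv_le_two_of_orderOf_pow_le (S : Finset ℕ)
    (hS : ∀ p ∈ S, p.Prime ∧ p ≠ 2 ∧ orderOf (2 : ZMod p) ^ 3 ≤ p) :
    ∑ p ∈ S, 1 / (p : ℝ) ≤ 2 := by
  have hpos : ∀ p ∈ S, 0 < orderOf (2 : ZMod p) := by
    intro p hp
    have hp' := hS p hp
    have := Fact.mk hp'.1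
    have h2 : (2 : ZMod p) ≠ 0 := by
      intro h
      have : p ∣ 2 := (ZMod.natCast_eq_zero_iff 2 p).1 (by exact_mod_cast h)
      exact hp'.2.1 ((Nat.prime_dvd_prime_iff_eq hp'.1 Nat.prime_two).1 this)
    rw [orderOf_pos_iff, isOfFinOrder_iff_pow_eq_one]
    exact ⟨p - 1, Nat.sub_pos_of_lt hp'.1.one_lt, ZMod.pow_card_sub_one_eq_one h2⟩
  set N := S.sup fun p => orderOf (2 : ZMod p) with hN
  have hmaps : ∀ p ∈ S, orderOf (2 : ZMod p) ∈ Finset.Ioc 0 N := fun p hp =>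
    Finset.mem_Ioc.2 ⟨hpos p hp, Finset.le_sup (f := fun p => orderOf (2 : ZMod p)) hp⟩
  rw [← Finset.sum_fiberwise_of_maps_to hmaps]
  refine (Finset.sum_le_sum fun e he => ?_).trans (sum_inv_sq_le_two N)
  have he0 : 0 < e := (Finset.mem_Ioc.1 he).1
  have her : (0 : ℝ) < e := by exact_mod_cast he0
  set T := S.filter fun p => orderOf (2 : ZMod p) = e with hT
  have hne : 2 ^ e - 1 ≠ 0 := by
    have := Nat.one_lt_two_pow he0.ne'
    lia
  have hsub : T ⊆ (2 ^ e - 1).primeFactors := by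
    intro p hp
    rw [hT, Finset.mem_filter] at hp
    refine Nat.mem_primeFactors.2 ⟨(hS p hp.1).1, ?_, hne⟩
    rw [← ZMod.natCast_eq_zero_iff, Nat.cast_sub Nat.one_le_two_pow]
    push_cast
    rw [← hp.2, pow_orderOf_eq_one, sub_self]
  have hcard : T.card ≤ e := (Finset.card_le_card hsub).trans
    (card_primeFactors_le hne (Nat.sub_lt (by positivity) one_pos))
  have h1 : ∑ p ∈ T, 1 / (p : ℝ) ≤ T.card • (1 / (e : ℝ) ^ 3) := by
    refine Finset.sum_le_card_nsmul _ _ _ fun p hp => ?_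
    rw [hT, Finset.mem_filter] at hp
    have h3 := (hS p hp.1).2.2
    rw [hp.2] at h3
    exact one_div_le_one_div_of_le (by positivity) (by exact_mod_cast h3)
  refine h1.trans ?_
  have hcr : (T.card : ℝ) ≤ e := by exact_mod_cast hcard
  rw [nsmul_eq_mul]
  calc (T.card : ℝ) * (1 / (e : ℝ) ^ 3) ≤ e * (1 / (e : ℝ) ^ 3) := by gcongr
    _ = 1 / (e : ℝ) ^ 2 := by field_simp

/-- Odd primes `p ≤ L` modulo which the order of `2` exceeds `p ^ (1 / 3)`. -/
noncomputable def largeOrderPrimes (L : ℕ) : Finset ℕ :=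
  (Finset.range (L + 1)).filter fun p => p.Prime ∧ p ≠ 2 ∧ p < orderOf (2 : ZMod p) ^ 3

lemma exists_singularFactor_le {ε : ℝ} (hε : 0 < ε) :
    ∃ C > (0 : ℝ), ∀ L h : ℕ, 1 ≤ L → h ≠ 0 → h < 2 ^ L →
      singularFactor h ≤ C * (1 + ∑ p ∈ (largeOrderPrimes L).filter (· ∣ h),
        (p : ℝ) ^ (ε - 1)) := by
  obtain ⟨C, hC, hP⟩ := exists_prod_primes_one_add_inv_le hε
  refine ⟨2 * Real.exp 1 * Real.exp 2 * (1 + C), by positivity, ?_⟩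
  intro L h hL hh hhL
  set S := h.primeFactors with hS
  have hone : ∀ q : ℕ, (1 : ℝ) ≤ 1 + 1 / (q : ℝ) := fun q => by
    have : (0 : ℝ) ≤ 1 / q := by positivity
    linarith
  set f : ℕ → ℝ := fun q => 1 + 1 / (q : ℝ) with hf
  set S₁ := S.filter (· = 2)
  set S₂ := S.filter (L < ·)
  set S₃ := S.filter fun p => p ≠ 2 ∧ orderOf (2 : ZMod p) ^ 3 ≤ p
  set S₄ := S.filter fun p => p ≤ L ∧ p ≠ 2 ∧ p < orderOf (2 : ZMod p) ^ 3
  have hsplit : singularFactor h ≤ (∏ p ∈ S₁, f p) * (∏ p ∈ S₂, f p) * (∏ p ∈ S₃, f p) *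
      ∏ p ∈ S₄, f p := by
    simp only [singularFactor, S₁, S₂, S₃, S₄, Finset.prod_filter]
    rw [← Finset.prod_mul_distrib, ← Finset.prod_mul_distrib, ← Finset.prod_mul_distrib]
    refine Finset.prod_le_prod (fun p _ => zero_le_one.trans (hone p)) fun p _ => ?_
    have h1 : ∀ (P : Prop) [Decidable P], 1 ≤ if P then f p else 1 := fun P _ => by
      split_ifs
      exacts [hone p, le_rfl]
    have h0 : 0 ≤ f p := zero_le_one.trans (hone p)
    have hm : ∀ {x y : ℝ}, 1 ≤ x → 1 ≤ y → 1 ≤ x * y := fun hx hy => one_le_mul_of_one_le_of_one_le hx hy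
    by_cases c1 : p = 2
    · rw [if_pos c1, mul_assoc, mul_assoc]
      exact le_mul_of_one_le_right h0 (hm (h1 _) (hm (h1 _) (h1 _)))
    by_cases c2 : L < p
    · rw [if_pos c2, mul_comm (ite _ _ _) (f p), mul_assoc, mul_assoc]
      exact le_mul_of_one_le_right h0 (hm (h1 _) (hm (h1 _) (h1 _)))
    by_cases c3 : orderOf (2 : ZMod p) ^ 3 ≤ p
    · rw [if_pos (⟨c1, c3⟩ : p ≠ 2 ∧ orderOf (2 : ZMod p) ^ 3 ≤ p), mul_comm (_ * _) (f p), mul_assoc]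
      exact le_mul_of_one_le_right h0 (hm (hm (h1 _) (h1 _)) (h1 _))
    · rw [if_pos (⟨not_lt.1 c2, c1, not_le.1 c3⟩ : p ≤ L ∧ p ≠ 2 ∧ p < orderOf (2 : ZMod p) ^ 3)]
      exact le_mul_of_one_le_left h0 (hm (hm (h1 _) (h1 _)) (h1 _))
  have hpr : ∀ p ∈ S, p.Prime := fun p hp => Nat.prime_of_mem_primeFactors hp
  have b1 : ∏ p ∈ S₁, f p ≤ 2 := by
    have : S₁ ⊆ {2} := fun p hp => Finset.mem_singleton.2 (Finset.mem_filter.1 hp).2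
    refine (Finset.prod_le_prod_of_subset_of_one_le this
      (fun q _ => zero_le_one.trans (hone q)) (fun q _ _ => hone q)).trans ?_
    simp only [Finset.prod_singleton]
    norm_num
  have b2 : ∏ p ∈ S₂, f p ≤ Real.exp 1 := by
    refine (prod_one_add_inv_le_exp _).trans (Real.exp_le_exp.2 ?_)
    have hLr : (0 : ℝ) < L := by exact_mod_cast hL
    have h1 : ∑ p ∈ S₂, 1 / (p : ℝ) ≤ S₂.card • (1 / (L : ℝ)) := by
      refine Finset.sum_le_card_nsmul _ _ _ fun p hp => ?_
      exact one_div_le_one_div_of_le hLr (by exact_mod_cast (Finset.mem_filter.1 hp).2.le)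
    have h2 : (S₂.card : ℝ) ≤ L := by
      exact_mod_cast (Finset.card_filter_le _ _).trans (card_primeFactors_le hh hhL)
    refine h1.trans ?_
    rw [nsmul_eq_mul, mul_one_div, div_le_one hLr]
    exact h2
  have b3 : ∏ p ∈ S₃, f p ≤ Real.exp 2 := by
    refine (prod_one_add_inv_le_exp _).trans (Real.exp_le_exp.2 ?_)
    exact sum_inv_le_two_of_orderOf_pow_le _ fun p hp =>
      ⟨hpr p (Finset.mem_filter.1 hp).1, (Finset.mem_filter.1 hp).2⟩
  have b4 : ∏ p ∈ S₄, f p ≤ 1 + C * ∑ p ∈ (largeOrderPrimes L).filter (· ∣ h),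
      (p : ℝ) ^ (ε - 1) := by
    simp only [hf]
    rw [Finset.prod_one_add_ordered, Finset.mul_sum]
    refine add_le_add le_rfl ?_
    calc _ ≤ ∑ p ∈ S₄, C * (p : ℝ) ^ (ε - 1) := by
          refine Finset.sum_le_sum fun p hp => ?_
          have hpp := hpr p (Finset.mem_filter.1 hp).1
          have hp0 : (0 : ℝ) < p := by exact_mod_cast hpp.pos
          have h1 : ∏ j ∈ S₄ with j < p, (1 + 1 / (j : ℝ)) ≤ C * (p : ℝ) ^ ε := by
            refine (Finset.prod_le_prod_of_subset_of_one_le ?_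
              (fun q _ => zero_le_one.trans (hone q)) (fun q _ _ => hone q)).trans (hP p hpp.pos)
            intro j hj
            rw [Finset.mem_filter] at hj
            exact Finset.mem_filter.2 ⟨Finset.mem_range.2 hj.2,
              hpr j (Finset.mem_filter.1 hj.1).1⟩
          calc _ ≤ 1 / (p : ℝ) * (C * (p : ℝ) ^ ε) := by gcongr
            _ = C * (p : ℝ) ^ (ε - 1) := by
              rw [Real.rpow_sub_one hp0.ne']
              ring
      _ ≤ _ := by
          refine Finset.sum_le_sum_of_subset_of_nonneg ?_ fun _ _ _ => by positivity
          intro p hp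
          rw [Finset.mem_filter] at hp
          rw [Finset.mem_filter, largeOrderPrimes, Finset.mem_filter, Finset.mem_range]
          exact ⟨⟨by lia, hpr p hp.1, hp.2.2⟩, Nat.dvd_of_mem_primeFactors hp.1⟩
  have n0 : ∀ T : Finset ℕ, 0 ≤ ∏ p ∈ T, f p := fun T =>
    Finset.prod_nonneg fun p _ => zero_le_one.trans (hone p)
  set Y := ∑ p ∈ (largeOrderPrimes L).filter (· ∣ h), (p : ℝ) ^ (ε - 1) with hY
  have hY0 : 0 ≤ Y := Finset.sum_nonneg fun _ _ => by positivity
  calc singularFactor h ≤ _ := hsplit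
    _ ≤ 2 * Real.exp 1 * Real.exp 2 * (1 + C * Y) := by
      have := n0 S₁
      have := n0 S₂
      have := n0 S₃
      have := n0 S₄
      gcongr
    _ ≤ 2 * Real.exp 1 * Real.exp 2 * ((1 + C) * (1 + Y)) := by
      gcongr
      nlinarith
    _ = _ := by ring

lemma exists_sum_offDiag_singularFactor_le {δ C₀ : ℝ} (hδ : 0 < δ) (hC₀ : 0 < C₀) :
    ∃ C > (0 : ℝ), ∀ (L : ℕ) (A : Finset ℕ), 1 ≤ L → (∀ a ∈ A, a < 2 ^ L) →
      (A.card : ℝ) ≤ C₀ * L →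
      (∀ p b : ℕ, p.Prime → p ≠ 2 → ((A.filter fun a => a ≡ b [MOD p]).card : ℝ) ≤
        C₀ * L * ((orderOf (2 : ZMod p) : ℝ) ^ (-δ) + (L : ℝ) ^ (-δ))) →
      ∑ x ∈ A.offDiag, singularFactor ((x.1 : ℤ) - x.2).natAbs ≤ C * (L : ℝ) ^ 2 := by
  obtain ⟨C, hC, hsf⟩ := exists_singularFactor_le (ε := δ / 6) (by positivity)
  have hsum : Summable fun n : ℕ => (n : ℝ) ^ (-1 - δ / 6) :=
    Real.summable_nat_rpow.2 (by linarith)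
  set Z := ∑' n : ℕ, (n : ℝ) ^ (-1 - δ / 6) with hZ
  have hZ0 : 0 ≤ Z := tsum_nonneg fun n => by positivity
  refine ⟨C * (C₀ ^ 2 + 2 * C₀ ^ 2 * Z), by positivity, ?_⟩
  intro L A hL hA hcard hres
  have hLr : (1 : ℝ) ≤ L := by exact_mod_cast hL
  have h1 : ∀ x ∈ A.offDiag, singularFactor ((x.1 : ℤ) - x.2).natAbs ≤
      C * (1 + ∑ p ∈ largeOrderPrimes L, if x.2 ≡ x.1 [MOD p] then (p : ℝ) ^ (δ / 6 - 1) else 0) := by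
    intro x hx
    rw [Finset.mem_offDiag] at hx
    have hx1 := hA _ hx.1
    have hx2 := hA _ hx.2.1
    have := hsf L ((x.1 : ℤ) - x.2).natAbs hL (by have := hx.2.2; lia)
      (by have : ((x.1 : ℤ) - x.2).natAbs ≤ max x.1 x.2 := by lia
          exact this.trans_lt (max_lt hx1 hx2))
    rw [Finset.sum_filter] at this
    refine this.trans_eq ?_
    congr 2
    refine Finset.sum_congr rfl fun p _ => if_congr ?_ rfl rfl
    rw [Nat.modEq_iff_dvd, Int.natCast_dvd]
  refine (Finset.sum_le_sum h1).trans ?_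
  rw [← Finset.mul_sum, mul_assoc]
  refine mul_le_mul_of_nonneg_left ?_ hC.le
  have hsub : A.offDiag ⊆ A ×ˢ A := fun x hx => by
    rw [Finset.mem_offDiag] at hx
    exact Finset.mem_product.2 ⟨hx.1, hx.2.1⟩
  refine (Finset.sum_le_sum_of_subset_of_nonneg hsub fun x _ _ => ?_).trans ?_
  · have : 0 ≤ ∑ p ∈ largeOrderPrimes L,
        if x.2 ≡ x.1 [MOD p] then (p : ℝ) ^ (δ / 6 - 1) else 0 :=
      Finset.sum_nonneg fun p _ => by split_ifs <;> positivity
    linarith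
  rw [Finset.sum_add_distrib, Finset.sum_comm]
  have hfirst : ∑ x ∈ A ×ˢ A, (1 : ℝ) ≤ C₀ ^ 2 * (L : ℝ) ^ 2 := by
    rw [Finset.sum_const, Finset.card_product, nsmul_eq_mul, mul_one, Nat.cast_mul, ← mul_pow, sq]
    gcongr
  have hsecond : ∀ p ∈ largeOrderPrimes L,
      ∑ x ∈ A ×ˢ A, (if x.2 ≡ x.1 [MOD p] then (p : ℝ) ^ (δ / 6 - 1) else 0) ≤
      2 * C₀ ^ 2 * (L : ℝ) ^ 2 * (p : ℝ) ^ (-1 - δ / 6) := by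
    intro p hp
    rw [largeOrderPrimes, Finset.mem_filter, Finset.mem_range] at hp
    obtain ⟨hpL, hpp, hp2, hord⟩ := hp
    have hp0 : (0 : ℝ) < p := by exact_mod_cast hpp.pos
    have hp1 : (1 : ℝ) ≤ p := by exact_mod_cast hpp.one_le
    have b1 : (orderOf (2 : ZMod p) : ℝ) ^ (-δ) ≤ (p : ℝ) ^ (-(δ / 3)) := by
      have h3 : (p : ℝ) ≤ (orderOf (2 : ZMod p) : ℝ) ^ 3 := by exact_mod_cast hord.le
      have : (orderOf (2 : ZMod p) : ℝ) ^ (-δ) =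
          ((orderOf (2 : ZMod p) : ℝ) ^ 3) ^ (-(δ / 3)) := by
        rw [← Real.rpow_natCast, ← Real.rpow_mul (by positivity)]
        congr 1
        push_cast
        ring
      rw [this]
      exact Real.rpow_le_rpow_of_nonpos hp0 h3 (by linarith)
    have b2 : (L : ℝ) ^ (-δ) ≤ (p : ℝ) ^ (-(δ / 3)) := by
      have hpL' : (p : ℝ) ≤ L := by exact_mod_cast (by lia : p ≤ L)
      exact (Real.rpow_le_rpow_of_nonpos hp0 hpL' (by linarith)).trans
        (Real.rpow_le_rpow_of_exponent_le hp1 (by linarith))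
    rw [Finset.sum_product]
    have h2 : ∀ a ∈ A, ∑ b ∈ A, (if b ≡ a [MOD p] then (p : ℝ) ^ (δ / 6 - 1) else 0) ≤
        2 * C₀ * L * (p : ℝ) ^ (-1 - δ / 6) := by
      intro a _
      rw [← Finset.sum_filter, Finset.sum_const, nsmul_eq_mul]
      calc _ ≤ C₀ * L * ((p : ℝ) ^ (-(δ / 3)) + (p : ℝ) ^ (-(δ / 3))) * (p : ℝ) ^ (δ / 6 - 1) := by
            gcongr
            refine (hres p a hpp hp2).trans ?_
            gcongr
        _ = 2 * C₀ * L * ((p : ℝ) ^ (-(δ / 3)) * (p : ℝ) ^ (δ / 6 - 1)) := by ring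
        _ = _ := by
          rw [← Real.rpow_add hp0]
          congr 2
          ring
    calc _ ≤ A.card • (2 * C₀ * L * (p : ℝ) ^ (-1 - δ / 6)) := Finset.sum_le_card_nsmul _ _ _ h2
      _ ≤ C₀ * L * (2 * C₀ * L * (p : ℝ) ^ (-1 - δ / 6)) := by
        rw [nsmul_eq_mul]
        gcongr
      _ = _ := by ring
  have h3 := Finset.sum_le_sum hsecond
  rw [← Finset.mul_sum] at h3
  have h4 : ∑ p ∈ largeOrderPrimes L, (p : ℝ) ^ (-1 - δ / 6) ≤ Z :=
    hsum.sum_le_tsum _ fun n _ => by positivity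
  have h5 : 2 * C₀ ^ 2 * (L : ℝ) ^ 2 * ∑ p ∈ largeOrderPrimes L, (p : ℝ) ^ (-1 - δ / 6) ≤
      2 * C₀ ^ 2 * (L : ℝ) ^ 2 * Z := by gcongr
  linarith

lemma card_primesBelow_two_pow_le {L : ℕ} (hL : 1 ≤ L) :
    ((2 ^ L).primesBelow.card : ℝ) ≤ 6 * 2 ^ L / L := by
  have hLr : (1 : ℝ) ≤ L := by exact_mod_cast hL
  have h1 := Chebyshev.pi_le_log4_mul_div (x := (2 : ℝ) ^ L)
    (one_lt_pow₀ (by norm_num) (by lia))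
  have e1 : ⌊(2 : ℝ) ^ L⌋₊ = 2 ^ L := by
    have : (2 : ℝ) ^ L = ((2 ^ L : ℕ) : ℝ) := by push_cast; rfl
    rw [this, Nat.floor_natCast]
  rw [e1] at h1
  have h2 : (2 ^ L).primesBelow.card ≤ (2 ^ L).primeCounting := by
    rw [Nat.primesBelow_card_eq_primeCounting']
    exact Nat.monotone_primeCounting' (Nat.le_succ _)
  have h3 : ((2 ^ L).primesBelow.card : ℝ) ≤ ((2 ^ L).primeCounting : ℝ) := by exact_mod_cast h2
  have hl2 : 0 < Real.log 2 := Real.log_pos (by norm_num)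
  have e2 : Real.log 4 = 2 * Real.log 2 := by
    rw [(by norm_num : (4 : ℝ) = 2 ^ 2), Real.log_pow]; push_cast; ring
  have e3 : Real.log √((2 : ℝ) ^ L) = L * Real.log 2 / 2 := by
    rw [Real.log_sqrt (by positivity), Real.log_pow]
  have e4 : Real.log 4 * 2 ^ L / Real.log √((2 : ℝ) ^ L) = 4 * 2 ^ L / L := by
    rw [e2, e3]; field_simp; ring
  have h4 : √((2 : ℝ) ^ L) ≤ 2 * 2 ^ L / L := by
    have h5 : (L : ℝ) ≤ 2 * √((2 : ℝ) ^ L) := by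
      have h6 : (L : ℝ) ^ 2 ≤ 4 * (2 : ℝ) ^ L := by
        have : ∀ n : ℕ, n ^ 2 ≤ 4 * 2 ^ n := by
          intro n
          induction n with
          | zero => norm_num
          | succ n ih =>
            rcases le_or_gt n 2 with h | h
            · interval_cases n <;> norm_num
            · rw [pow_succ 2 n]; nlinarith
        exact_mod_cast this L
      rw [← abs_of_nonneg (by positivity : (0 : ℝ) ≤ L), ← Real.sqrt_sq_eq_abs]
      calc √((L : ℝ) ^ 2) ≤ √(4 * (2 : ℝ) ^ L) := Real.sqrt_le_sqrt h6
        _ = _ := by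
          rw [Real.sqrt_mul (by norm_num), (by norm_num : (4 : ℝ) = 2 ^ 2),
            Real.sqrt_sq (by norm_num)]
    rw [le_div_iff₀ (by linarith)]
    have := Real.mul_self_sqrt (by positivity : (0 : ℝ) ≤ 2 ^ L)
    nlinarith [Real.sqrt_nonneg ((2 : ℝ) ^ L)]
  rw [e4] at h1
  have e5 : 6 * (2 : ℝ) ^ L / L = 4 * 2 ^ L / L + 2 * 2 ^ L / L := by ring
  linarith

lemma le_card_primesBelow_two_pow {L : ℕ} (hL : 5 ≤ L) :
    (2 : ℝ) ^ L / (2 * L) ≤ ((2 ^ L).primesBelow.card : ℝ) := by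
  have hLr : (5 : ℝ) ≤ L := by exact_mod_cast hL
  have h1 := Chebyshev.pi_ge (2 ^ L)
  have h2 : (2 ^ L).primeCounting ≤ (2 ^ L).primesBelow.card + 1 := by
    rw [Nat.primesBelow_card_eq_primeCounting', Nat.primeCounting, Nat.primeCounting',
      Nat.count_succ]
    split_ifs <;> lia
  have h3 : ((2 ^ L).primeCounting : ℝ) ≤ ((2 ^ L).primesBelow.card : ℝ) + 1 := by
    exact_mod_cast h2
  have hl2 : 0 < Real.log 2 := Real.log_pos (by norm_num)
  push_cast at h1
  have h4 : Real.log ((2 : ℝ) ^ L + 1) ≤ (L + 1) * Real.log 2 := by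
    have : (2 : ℝ) ^ L + 1 ≤ 2 ^ (L + 1) := by
      rw [pow_succ]
      linarith [one_le_pow₀ (by norm_num : (1 : ℝ) ≤ 2) (n := L)]
    refine (Real.log_le_log (by positivity) this).trans_eq ?_
    rw [Real.log_pow]
    push_cast
    rfl
  rw [Real.log_pow] at h1
  have h5 : ((2 : ℝ) ^ L - (L + 1)) / L ≤ (2 ^ L * Real.log 2 - Real.log (2 ^ L + 1)) /
      (L * Real.log 2) := by
    rw [div_le_div_iff₀ (by linarith) (by positivity)]
    nlinarith
  have h6 : (4 * L + 2 : ℝ) ≤ 2 ^ L := by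
    have : ∀ n : ℕ, 5 ≤ n → 4 * n + 2 ≤ 2 ^ n := by
      intro n hn
      induction n, hn using Nat.le_induction with
      | base => norm_num
      | succ n hn ih => rw [pow_succ]; lia
    exact_mod_cast this L hL
  have h7 : (2 : ℝ) ^ L / (2 * L) + 1 ≤ (2 ^ L - (L + 1)) / L := by
    rw [div_add_one (by positivity), div_le_div_iff₀ (by positivity) (by linarith)]
    nlinarith
  linarith

lemma card_filter_add_eq_add_le (X a b : ℕ) :
    ((X.primesBelow ×ˢ X.primesBelow).filter fun x => x.1 + a = x.2 + b).card ≤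
      ((Finset.range X).filter fun n => n.Prime ∧ (n + ((a : ℤ) - b).natAbs).Prime).card := by
  rcases le_total a b with h | h
  · refine Finset.card_le_card_of_injOn Prod.snd ?_ ?_
    · intro x hx
      simp only [Finset.coe_filter, Finset.mem_product, Nat.mem_primesBelow,
        Set.mem_ofPred_eq, Finset.mem_range] at hx ⊢
      refine ⟨hx.1.2.1, hx.1.2.2, ?_⟩
      rw [(by lia : x.2 + ((a : ℤ) - b).natAbs = x.1)]
      exact hx.1.1.2
    · intro x hx y hy hxy
      simp only [Finset.coe_filter, Set.mem_ofPred_eq] at hx hy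
      exact Prod.ext (by lia) hxy
  · refine Finset.card_le_card_of_injOn Prod.fst ?_ ?_
    · intro x hx
      simp only [Finset.coe_filter, Finset.mem_product, Nat.mem_primesBelow,
        Set.mem_ofPred_eq, Finset.mem_range] at hx ⊢
      refine ⟨hx.1.1.1, hx.1.1.2, ?_⟩
      rw [(by lia : x.1 + ((a : ℤ) - b).natAbs = x.2)]
      exact hx.1.2.2
    · intro x hx y hy hxy
      simp only [Finset.coe_filter, Set.mem_ofPred_eq] at hx hy
      exact Prod.ext hxy (by lia)

lemma addEnergy_primesBelow_le (X : ℕ) (A : Finset ℕ) :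
    X.primesBelow.addEnergy A ≤ A.card * X.primesBelow.card +
      ∑ x ∈ A.offDiag, ((Finset.range X).filter fun n =>
        n.Prime ∧ (n + ((x.1 : ℤ) - x.2).natAbs).Prime).card := by
  have hmaps : ∀ y ∈ ((X.primesBelow ×ˢ X.primesBelow) ×ˢ A ×ˢ A).filter fun x =>
      x.1.1 + x.2.1 = x.1.2 + x.2.2, y.2 ∈ A ×ˢ A := fun y hy =>
    (Finset.mem_product.1 (Finset.mem_filter.1 hy).1).2
  rw [Finset.addEnergy, Finset.card_eq_sum_card_fiberwise hmaps]
  have hfib : ∀ z ∈ A ×ˢ A, ((((X.primesBelow ×ˢ X.primesBelow) ×ˢ A ×ˢ A).filter fun x =>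
      x.1.1 + x.2.1 = x.1.2 + x.2.2).filter fun x => x.2 = z).card ≤
      ((Finset.range X).filter fun n => n.Prime ∧ (n + ((z.1 : ℤ) - z.2).natAbs).Prime).card := by
    intro z _
    refine le_trans ?_ (card_filter_add_eq_add_le X z.1 z.2)
    refine Finset.card_le_card_of_injOn Prod.fst ?_ ?_
    · intro x hx
      simp only [Finset.coe_filter, Finset.mem_filter, Set.mem_ofPred_eq] at hx ⊢
      refine ⟨(Finset.mem_product.1 hx.1.1).1, ?_⟩
      rw [← hx.2]
      exact hx.1.2
    · intro x hx y hy hxy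
      simp only [Finset.coe_filter, Set.mem_ofPred_eq] at hx hy
      exact Prod.ext hxy (hx.2.trans hy.2.symm)
  refine (Finset.sum_le_sum hfib).trans ?_
  rw [← Finset.diag_union_offDiag, Finset.sum_union (Finset.disjoint_diag_offDiag A)]
  refine Nat.add_le_add_right (le_of_eq ?_) _
  rw [Finset.sum_diag]
  simp only [sub_self, Int.natAbs_zero, add_zero, and_self]
  rw [Finset.sum_const, smul_eq_mul]
  rfl

open scoped Pointwise in
/-- Romanoff's second moment argument: if the finite sets `A` of even numbers below `2 ^ L` have
about `L` elements and are not too concentrated in residue classes modulo odd primes, then the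
sumset of `A` and the primes below `2 ^ L` has positive proportion. -/
lemma exists_le_card_primesBelow_add {δ C₀ c₀ : ℝ} (hδ : 0 < δ) (hC₀ : 0 < C₀) (hc₀ : 0 < c₀) :
    ∃ c > (0 : ℝ), ∀ (L : ℕ) (A : Finset ℕ), 24 ≤ L → (∀ a ∈ A, Even a ∧ a < 2 ^ L) →
      c₀ * L ≤ A.card → (A.card : ℝ) ≤ C₀ * L →
      (∀ p b : ℕ, p.Prime → p ≠ 2 → ((A.filter fun a => a ≡ b [MOD p]).card : ℝ) ≤
        C₀ * L * ((orderOf (2 : ZMod p) : ℝ) ^ (-δ) + (L : ℝ) ^ (-δ))) →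
      c * 2 ^ L ≤ (((2 ^ L).primesBelow + A).card : ℝ) := by
  obtain ⟨C, hC, hsing⟩ := exists_sum_offDiag_singularFactor_le hδ hC₀
  set D := 6 * C₀ + 8 * 96 ^ 2 * C + 32 * C₀ ^ 2 with hD
  have hD0 : 0 < D := by positivity
  refine ⟨c₀ ^ 2 / (4 * D), by positivity, ?_⟩
  intro L A hL hA hcard hcard' hres
  have hLr : (24 : ℝ) ≤ L := by exact_mod_cast hL
  have hl2 : (1 / 2 : ℝ) ≤ Real.log 2 := by linarith [Real.log_two_gt_d9]
  set N := 2 ^ (L / 24) with hN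
  have hN1 : 1 ≤ N := Nat.one_le_two_pow
  have hlogN : (L : ℝ) / 96 ≤ Real.log (N + 1) := by
    have h1 : Real.log ((2 : ℝ) ^ (L / 24)) ≤ Real.log (N + 1) := by
      refine Real.log_le_log (by positivity) ?_
      rw [hN]
      push_cast
      linarith
    rw [Real.log_pow] at h1
    have h2 : (L : ℝ) / 48 ≤ ((L / 24 : ℕ) : ℝ) := by
      rw [div_le_iff₀ (by norm_num)]
      exact_mod_cast (by lia : L ≤ L / 24 * 48)
    nlinarith
  have hN12 : (L : ℝ) ^ 2 * (N : ℝ) ^ 12 ≤ 16 * 2 ^ L := by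
    have h1 : L ≤ 4 * 2 ^ (L / 4) := by
      have := Nat.lt_two_pow_self (n := L / 4)
      lia
    have h2 : L ^ 2 * N ^ 12 ≤ 16 * 2 ^ L := by
      calc L ^ 2 * N ^ 12 ≤ (4 * 2 ^ (L / 4)) ^ 2 * N ^ 12 := by gcongr
        _ = 16 * 2 ^ (L / 4 * 2 + L / 24 * 12) := by
          rw [hN, mul_pow, ← pow_mul, ← pow_mul, pow_add]
          ring
        _ ≤ 16 * 2 ^ L := by
          gcongr
          · norm_num
          · lia
    exact_mod_cast h2
  have hoff : ∑ x ∈ A.offDiag, (((Finset.range (2 ^ L)).filter fun n =>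
      n.Prime ∧ (n + ((x.1 : ℤ) - x.2).natAbs).Prime).card : ℝ) ≤
      (8 * 96 ^ 2 * C + 32 * C₀ ^ 2) * 2 ^ L := by
    have h1 : ∀ x ∈ A.offDiag, (((Finset.range (2 ^ L)).filter fun n =>
        n.Prime ∧ (n + ((x.1 : ℤ) - x.2).natAbs).Prime).card : ℝ) ≤
        8 * 96 ^ 2 * 2 ^ L / (L : ℝ) ^ 2 * singularFactor ((x.1 : ℤ) - x.2).natAbs +
          2 * (N : ℝ) ^ 12 := by
      intro x hx
      rw [Finset.mem_offDiag] at hx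
      have he : Even ((x.1 : ℤ) - x.2).natAbs := by
        rw [Int.natAbs_even]
        exact ((Int.even_coe_nat _).2 (hA _ hx.1).1).sub ((Int.even_coe_nat _).2 (hA _ hx.2.1).1)
      have h0 : ((x.1 : ℤ) - x.2).natAbs ≠ 0 := by have := hx.2.2; lia
      refine (card_primePairs_le he h0 (2 ^ L) hN1).trans ?_
      have hsf := one_le_singularFactor ((x.1 : ℤ) - x.2).natAbs
      have h2 : (L / 96 : ℝ) ^ 2 ≤ Real.log (N + 1) ^ 2 := by gcongr
      have h3 : 8 * ((2 ^ L : ℕ) : ℝ) * singularFactor ((x.1 : ℤ) - x.2).natAbs /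
          Real.log (N + 1) ^ 2 ≤ 8 * ((2 ^ L : ℕ) : ℝ) *
          singularFactor ((x.1 : ℤ) - x.2).natAbs / (L / 96 : ℝ) ^ 2 := by
        gcongr
      refine (add_le_add_left h3 _).trans (le_of_eq ?_)
      push_cast
      field_simp
    refine (Finset.sum_le_sum h1).trans ?_
    rw [Finset.sum_add_distrib, ← Finset.mul_sum, Finset.sum_const, nsmul_eq_mul]
    have h2 := hsing L A (by lia) (fun a ha => (hA a ha).2) hcard' hres
    have h3 : 8 * 96 ^ 2 * 2 ^ L / (L : ℝ) ^ 2 *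
        ∑ x ∈ A.offDiag, singularFactor ((x.1 : ℤ) - x.2).natAbs ≤ 8 * 96 ^ 2 * C * 2 ^ L := by
      calc _ ≤ 8 * 96 ^ 2 * 2 ^ L / (L : ℝ) ^ 2 * (C * (L : ℝ) ^ 2) := by gcongr
        _ = _ := by field_simp
    have h4 : (A.offDiag.card : ℝ) ≤ (C₀ * L) ^ 2 := by
      have : A.offDiag.card ≤ A.card * A.card := by
        rw [Finset.offDiag_card]
        exact Nat.sub_le _ _
      calc (A.offDiag.card : ℝ) ≤ (A.card : ℝ) * A.card := by exact_mod_cast this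
        _ ≤ (C₀ * L) * (C₀ * L) := by gcongr
        _ = _ := by ring
    have h5 : (A.offDiag.card : ℝ) * (2 * (N : ℝ) ^ 12) ≤ 32 * C₀ ^ 2 * 2 ^ L := by
      calc _ ≤ (C₀ * L) ^ 2 * (2 * (N : ℝ) ^ 12) := by gcongr
        _ = 2 * C₀ ^ 2 * ((L : ℝ) ^ 2 * (N : ℝ) ^ 12) := by ring
        _ ≤ 2 * C₀ ^ 2 * (16 * 2 ^ L) := by gcongr
        _ = _ := by ring
    linarith
  have hπ' := card_primesBelow_two_pow_le (L := L) (by lia)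
  have hπ := le_card_primesBelow_two_pow (L := L) (by lia)
  have hE : ((2 ^ L).primesBelow.addEnergy A : ℝ) ≤ D * 2 ^ L := by
    have h1 : ((2 ^ L).primesBelow.addEnergy A : ℝ) ≤ A.card * (2 ^ L).primesBelow.card +
        ∑ x ∈ A.offDiag, (((Finset.range (2 ^ L)).filter fun n =>
          n.Prime ∧ (n + ((x.1 : ℤ) - x.2).natAbs).Prime).card : ℝ) := by
      exact_mod_cast addEnergy_primesBelow_le (2 ^ L) A
    have h2 : (A.card : ℝ) * (2 ^ L).primesBelow.card ≤ 6 * C₀ * 2 ^ L := by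
      calc _ ≤ C₀ * L * (6 * 2 ^ L / L) := by gcongr
        _ = _ := by field_simp
    rw [hD]
    linarith
  have hCS : ((2 ^ L).primesBelow.card : ℝ) ^ 2 * (A.card : ℝ) ^ 2 ≤
      ((2 ^ L).primesBelow + A).card * ((2 ^ L).primesBelow.addEnergy A : ℝ) := by
    exact_mod_cast Finset.le_card_add_mul_addEnergy (2 ^ L).primesBelow A
  have hlow : (2 ^ L / (2 * L) : ℝ) ^ 2 * (c₀ * L) ^ 2 ≤
      ((2 ^ L).primesBelow.card : ℝ) ^ 2 * (A.card : ℝ) ^ 2 := by gcongr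
  have e : (2 ^ L / (2 * L) : ℝ) ^ 2 * (c₀ * L) ^ 2 = c₀ ^ 2 / 4 * 2 ^ L * 2 ^ L := by
    field_simp
    ring
  rw [e] at hlow
  have h2 : c₀ ^ 2 / 4 * 2 ^ L * 2 ^ L ≤ (((2 ^ L).primesBelow + A).card : ℝ) * D * 2 ^ L := by
    refine (hlow.trans hCS).trans ?_
    rw [mul_assoc]
    gcongr
  have h3 := le_of_mul_le_mul_right h2 (by positivity)
  rw [div_mul_eq_mul_div, div_le_iff₀ (by positivity)]
  linarith

lemma injOn_sum_two_pow {ι : Type*} [Fintype ι] [DecidableEq ι] (u : ι → ℕ → ℕ)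
    (S : ι → Finset ℕ)
    (hu : ∀ i j, ∀ k ∈ S i, ∀ l ∈ S j, u i k = u j l → i = j ∧ k = l) :
    Set.InjOn (fun k : ι → ℕ => ∑ i, 2 ^ u i (k i)) (Fintype.piFinset S : Set (ι → ℕ)) := by
  intro k hk l hl h
  rw [Finset.mem_coe, Fintype.mem_piFinset] at hk hl
  have hsum : ∀ m : ι → ℕ, (∀ i, m i ∈ S i) →
      ∑ i, 2 ^ u i (m i) = ∑ e ∈ Finset.univ.image (fun i => u i (m i)), 2 ^ e := by
    intro m hm
    rw [Finset.sum_image]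
    intro i _ j _ hij
    exact (hu i j _ (hm i) _ (hm j) hij).1
  simp only at h
  rw [hsum k hk, hsum l hl] at h
  have h' := Finset.geomSum_injective le_rfl h
  funext i
  have hi : u i (k i) ∈ Finset.univ.image (fun i => u i (l i)) := by
    rw [← h']
    exact Finset.mem_image_of_mem (fun i => u i (k i)) (Finset.mem_univ i)
  obtain ⟨j, _, hj⟩ := Finset.mem_image.1 hi
  obtain ⟨rfl, h2⟩ := hu j i _ (hl j) _ (hk i) hj
  exact h2.symm

lemma sum_two_pow_lt {ι : Type*} [Fintype ι] [DecidableEq ι] {v : ι → ℕ}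
    (hv : Function.Injective v) {L : ℕ} (hL : ∀ i, v i < L) : ∑ i, 2 ^ v i < 2 ^ L := by
  have : ∑ i, 2 ^ v i = ∑ e ∈ Finset.univ.image v, 2 ^ e := by
    rw [Finset.sum_image]
    exact fun i _ j _ hij => hv hij
  rw [this]
  refine Nat.geomSum_lt le_rfl fun e he => ?_
  obtain ⟨i, _, rfl⟩ := Finset.mem_image.1 he
  exact hL i

lemma orderOf_two_pos {p : ℕ} (hp : p.Prime) (hp2 : p ≠ 2) : 0 < orderOf (2 : ZMod p) := by
  have := Fact.mk hp
  rw [orderOf_pos_iff, isOfFinOrder_iff_pow_eq_one]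
  refine ⟨p - 1, Nat.sub_pos_of_lt hp.one_lt, ZMod.pow_card_sub_one_eq_one ?_⟩
  intro h
  have h2 : ((2 : ℕ) : ZMod p) = 0 := by exact_mod_cast h
  rw [ZMod.natCast_eq_zero_iff] at h2
  exact hp2 ((Nat.prime_dvd_prime_iff_eq hp Nat.prime_two).1 h2)

lemma modEq_orderOf_of_two_pow_eq {p : ℕ} (hp : p.Prime) (hp2 : p ≠ 2) {m n : ℕ}
    (h : (2 : ZMod p) ^ m = 2 ^ n) : m ≡ n [MOD orderOf (2 : ZMod p)] := by
  have hfin : IsOfFinOrder (2 : ZMod p) := orderOf_pos_iff.1 (orderOf_two_pos hp hp2)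
  exact hfin.pow_eq_pow_iff_modEq.1 h

/-- Fixing all coordinates but one, a residue class modulo `p` for a sum of powers of two
constrains the exponent in the remaining coordinate modulo the order of `2`. -/
lemma card_filter_image_sum_two_pow_le {ι : Type*} [Fintype ι] [DecidableEq ι] (u : ι → ℕ → ℕ)
    (S : ι → Finset ℕ) (i₀ : ι) {p : ℕ} (hp : p.Prime) (hp2 : p ≠ 2) (b M : ℕ)
    (hM : ∀ c, ((S i₀).filter fun k => u i₀ k ≡ c [MOD orderOf (2 : ZMod p)]).card ≤ M) :
    ((((Fintype.piFinset S).image fun k => ∑ i, 2 ^ u i (k i)).filter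
      fun a => a ≡ b [MOD p]).card) ≤ M * ∏ i ∈ Finset.univ \ {i₀}, (S i).card := by
  classical
  rw [Finset.filter_image]
  refine Finset.card_image_le.trans ?_
  set T := (Fintype.piFinset S).filter fun k => ∑ i, 2 ^ u i (k i) ≡ b [MOD p] with hT
  have hfib : T.card ≤ M * (T.image fun k => Function.update k i₀ 0).card := by
    refine Finset.card_le_mul_card_image _ _ fun a _ => ?_
    rcases (T.filter fun k => Function.update k i₀ 0 = a).eq_empty_or_nonempty with h | ⟨x, hx⟩
    · rw [h]; simp
    · refine le_trans ?_ (hM (u i₀ (x i₀)))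
      rw [Finset.mem_filter, hT, Finset.mem_filter] at hx
      have hagree : ∀ k : ι → ℕ, Function.update k i₀ 0 = a → ∀ i, i ≠ i₀ → k i = x i := by
        intro k hk i hi
        have := congrFun (hk.trans hx.2.symm) i
        rwa [Function.update_of_ne hi, Function.update_of_ne hi] at this
      refine Finset.card_le_card_of_injOn (fun k => k i₀) ?_ ?_
      · intro k hk
        rw [Finset.mem_coe, Finset.mem_filter, hT, Finset.mem_filter, Fintype.mem_piFinset] at hk
        rw [Finset.mem_coe, Finset.mem_filter]
        refine ⟨hk.1.1 i₀, modEq_orderOf_of_two_pow_eq hp hp2 ?_⟩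
        have h1 := (ZMod.natCast_eq_natCast_iff _ _ _).2 (hk.1.2.trans hx.1.2.symm)
        push_cast at h1
        rw [← Finset.add_sum_erase _ _ (Finset.mem_univ i₀),
          ← Finset.add_sum_erase _ _ (Finset.mem_univ i₀)] at h1
        rw [Finset.sum_congr rfl (g := fun i => (2 : ZMod p) ^ u i (x i))] at h1
        · exact add_right_cancel h1
        · intro i hi
          rw [hagree k hk.2 i (Finset.ne_of_mem_erase hi)]
      · intro k hk l hl hkl
        rw [Finset.mem_coe, Finset.mem_filter] at hk hl
        funext i
        by_cases hi : i = i₀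
        · rw [hi]; exact hkl
        · rw [hagree k hk.2 i hi, hagree l hl.2 i hi]
  refine hfib.trans (Nat.mul_le_mul_left _ ?_)
  have hsub : (T.image fun k => Function.update k i₀ 0) ⊆
      Fintype.piFinset (Function.update S i₀ {0}) := by
    intro y hy
    obtain ⟨k, hk, rfl⟩ := Finset.mem_image.1 hy
    rw [hT, Finset.mem_filter, Fintype.mem_piFinset] at hk
    rw [Fintype.mem_piFinset]
    intro i
    by_cases hi : i = i₀
    · subst hi; simp
    · rw [Function.update_of_ne hi, Function.update_of_ne hi]; exact hk.1 i
  refine (Finset.card_le_card hsub).trans ?_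
  rw [Fintype.card_piFinset]
  have : (fun i => (Function.update S i₀ {0} i).card) =
      Function.update (fun i => (S i).card) i₀ 1 := by
    funext i
    by_cases hi : i = i₀
    · subst hi; simp
    · rw [Function.update_of_ne hi, Function.update_of_ne hi]
  rw [this, Finset.prod_update_of_mem (Finset.mem_univ i₀), one_mul]

lemma half_le_natFloor {x : ℝ} (hx : 1 ≤ x) : x / 2 ≤ (⌊x⌋₊ : ℝ) := by
  have h1 : (1 : ℝ) ≤ (⌊x⌋₊ : ℝ) := by exact_mod_cast Nat.le_floor (by simpa using hx)
  have h2 := Nat.lt_floor_add_one x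
  linarith

lemma natFloor_rpow_lt_natFloor_rpow {r : ℝ} (hr : 1 ≤ r) {m n : ℕ} (hmn : m < n) :
    ⌊(m : ℝ) ^ r⌋₊ < ⌊(n : ℝ) ^ r⌋₊ := by
  have h1 : (m : ℝ) ^ r + 1 ≤ (n : ℝ) ^ r := by
    calc (m : ℝ) ^ r + 1 = (m : ℝ) ^ r + 1 ^ r := by rw [Real.one_rpow]
      _ ≤ ((m : ℝ) + 1) ^ r := Real.add_rpow_le_rpow_add (by positivity) zero_le_one hr
      _ ≤ (n : ℝ) ^ r := by
        refine Real.rpow_le_rpow (by positivity) ?_ (by linarith)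
        exact_mod_cast hmn
  have h2 := Nat.floor_le_floor h1
  rw [Nat.floor_add_one (by positivity)] at h2
  omega

lemma natFloor_rpow_inv_bounds {ρ Y : ℝ} (hρ : 0 < ρ) (hY : 1 ≤ Y) :
    1 ≤ ⌊Y ^ ρ⁻¹⌋₊ ∧ (⌊Y ^ ρ⁻¹⌋₊ : ℝ) ≤ Y ^ ρ⁻¹ ∧ Y ^ ρ⁻¹ / 2 ≤ (⌊Y ^ ρ⁻¹⌋₊ : ℝ) ∧
      ∀ k ∈ Finset.Ico ⌊Y ^ ρ⁻¹⌋₊ (2 * ⌊Y ^ ρ⁻¹⌋₊),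
        1 ≤ k ∧ Y / 2 ^ ρ ≤ (k : ℝ) ^ ρ ∧ (k : ℝ) ^ ρ < 2 ^ ρ * Y := by
  have hX : 1 ≤ Y ^ ρ⁻¹ := Real.one_le_rpow hY (by positivity)
  have hXρ : (Y ^ ρ⁻¹) ^ ρ = Y := by
    rw [← Real.rpow_mul (by linarith), inv_mul_cancel₀ hρ.ne', Real.rpow_one]
  have h1 : 1 ≤ ⌊Y ^ ρ⁻¹⌋₊ := Nat.le_floor (by simpa using hX)
  have h2 : (⌊Y ^ ρ⁻¹⌋₊ : ℝ) ≤ Y ^ ρ⁻¹ := Nat.floor_le (by linarith)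
  have h3 := half_le_natFloor hX
  refine ⟨h1, h2, h3, fun k hk => ?_⟩
  rw [Finset.mem_Ico] at hk
  have hk1 : (⌊Y ^ ρ⁻¹⌋₊ : ℝ) ≤ k := by exact_mod_cast hk.1
  have hk2 : (k : ℝ) < 2 * ⌊Y ^ ρ⁻¹⌋₊ := by exact_mod_cast hk.2
  refine ⟨h1.trans hk.1, ?_, ?_⟩
  · calc Y / 2 ^ ρ = (Y ^ ρ⁻¹ / 2) ^ ρ := by
          rw [Real.div_rpow (by linarith) (by norm_num), hXρ]
      _ ≤ (k : ℝ) ^ ρ := Real.rpow_le_rpow (by linarith) (by linarith) hρ.le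
  · calc (k : ℝ) ^ ρ < (2 * Y ^ ρ⁻¹) ^ ρ :=
          Real.rpow_lt_rpow (by positivity) (by linarith) hρ
      _ = 2 ^ ρ * Y := by rw [Real.mul_rpow (by norm_num) (by linarith), hXρ]

set_option maxHeartbeats 400000 in
lemma exists_finset_sum_two_pow {s : ℕ} {ρ : Fin s → ℝ} (hρ : ∀ i, 0 < ρ i)
    (hsum : ∑ i, (ρ i)⁻¹ = 1) {u : Fin s → ℕ → ℕ} {α : ℝ} (hα : 0 < α) (hα1 : α ≤ 1)
    (hlow : ∀ i (k : ℕ), 1 ≤ k → α * (k : ℝ) ^ ρ i ≤ u i k)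
    (hup : ∀ i (k : ℕ), 1 ≤ k → (u i k : ℝ) ≤ (k : ℝ) ^ ρ i) (hmono : ∀ i, StrictMono (u i))
    (i₀ : Fin s)
    (hdist : ∃ C > (0 : ℝ), ∃ δ > (0 : ℝ), ∀ (K e c : ℕ), 1 ≤ K → 1 ≤ e →
      (((Finset.Ico K (2 * K)).filter fun k : ℕ => u i₀ k ≡ c [MOD e]).card : ℝ) ≤
      C * K * ((e : ℝ) ^ (-δ) + (K : ℝ) ^ (-δ))) :
    ∃ δ > (0 : ℝ), ∃ C₀ > (0 : ℝ), ∃ c₀ > (0 : ℝ), ∃ L₀ : ℕ, ∀ L : ℕ, L₀ ≤ L →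
      ∃ A : Finset ℕ, (∀ a ∈ A, ∃ k : Fin s → ℕ, (∀ i, 0 < k i) ∧ a = ∑ i, 2 ^ u i (k i)) ∧
      (∀ a ∈ A, Even a ∧ a < 2 ^ L) ∧ c₀ * L ≤ A.card ∧ (A.card : ℝ) ≤ C₀ * L ∧
      ∀ p b : ℕ, p.Prime → p ≠ 2 → ((A.filter fun a => a ≡ b [MOD p]).card : ℝ) ≤
        C₀ * L * ((orderOf (2 : ZMod p) : ℝ) ^ (-δ) + (L : ℝ) ^ (-δ)) := by
  obtain ⟨C, hC, δ, hδ, hdist⟩ := hdist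
  set B : ℝ := ∑ i, (2 : ℝ) ^ ρ i with hB
  have hBi : ∀ i, (2 : ℝ) ^ ρ i ≤ B := fun i =>
    Finset.single_le_sum (f := fun i => (2 : ℝ) ^ ρ i) (fun j _ => by positivity)
      (Finset.mem_univ i)
  have hB1 : 1 ≤ B := (Real.one_le_rpow (by norm_num) (hρ i₀).le).trans (hBi i₀)
  have hB0 : 0 < B := by linarith
  set q : ℝ := α / B ^ 2 with hq
  have hq0 : 0 < q := by positivity
  have hqB : q * B = α / B := by rw [hq]; field_simp
  have hαB : α / B ≤ 1 := by rw [div_le_one hB0]; linarith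
  have hq1 : q ≤ 1 := by
    rw [hq, div_le_one (by positivity)]; nlinarith
  set θ : Fin s → ℝ := fun i => q ^ ((i : ℕ) + 1) with hθ
  have hθ0 : ∀ i, 0 < θ i := fun i => by positivity
  have hθs : ∀ i, q ^ s ≤ θ i := fun i => pow_le_pow_of_le_one hq0.le hq1 i.2
  set Θ : ℝ := ∏ i, (θ i) ^ (ρ i)⁻¹ with hΘ
  have hΘ0 : 0 < Θ := Finset.prod_pos fun i _ => Real.rpow_pos_of_pos (hθ0 i) _
  have hprod : ∀ L : ℕ, 1 ≤ L → ∏ i, (θ i * L) ^ (ρ i)⁻¹ = Θ * L := by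
    intro L hL
    have hL' : (0 : ℝ) < L := by exact_mod_cast hL
    rw [Finset.prod_congr rfl fun i _ => Real.mul_rpow (hθ0 i).le hL'.le,
      Finset.prod_mul_distrib, ← Real.rpow_sum_of_pos hL', hsum, Real.rpow_one]
  clear_value Θ
  set δ' : ℝ := min δ (δ * (ρ i₀)⁻¹) with hδ'
  have hδ'0 : 0 < δ' := lt_min hδ (mul_pos hδ (inv_pos.2 (hρ i₀)))
  have hδ1 : δ' ≤ δ := min_le_left _ _
  have hδ2 : δ' ≤ δ * (ρ i₀)⁻¹ := min_le_right _ _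
  clear_value δ'
  set C' : ℝ := ((θ i₀) ^ (ρ i₀)⁻¹ / 2) ^ (-δ) with hC'
  have hC'0 : 0 < C' := by
    have := Real.rpow_pos_of_pos (hθ0 i₀) (ρ i₀)⁻¹
    positivity
  clear_value C'
  refine ⟨δ', hδ'0, Θ * (1 + C * (1 + C')), by positivity, Θ / 2 ^ s, by positivity,
    ⌈(q ^ s)⁻¹⌉₊ + 1, fun L hL => ?_⟩
  have hL1 : 1 ≤ L := by omega
  have hL0 : (0 : ℝ) < L := by exact_mod_cast hL1
  have hY : ∀ i, 1 ≤ θ i * L := by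
    intro i
    have h1 : (q ^ s)⁻¹ ≤ (L : ℝ) := (Nat.le_ceil _).trans (by exact_mod_cast (by omega))
    calc (1 : ℝ) = q ^ s * (q ^ s)⁻¹ := by rw [mul_inv_cancel₀ (by positivity)]
      _ ≤ θ i * L := mul_le_mul (hθs i) h1 (by positivity) (hθ0 i).le
  set K : Fin s → ℕ := fun i => ⌊(θ i * L) ^ (ρ i)⁻¹⌋₊ with hK
  have hb : ∀ i, 1 ≤ K i ∧ (K i : ℝ) ≤ (θ i * L) ^ (ρ i)⁻¹ ∧
      (θ i * L) ^ (ρ i)⁻¹ / 2 ≤ (K i : ℝ) ∧ ∀ k ∈ Finset.Ico (K i) (2 * K i),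
        1 ≤ k ∧ θ i * L / 2 ^ ρ i ≤ (k : ℝ) ^ ρ i ∧ (k : ℝ) ^ ρ i < 2 ^ ρ i * (θ i * L) :=
    fun i => natFloor_rpow_inv_bounds (hρ i) (hY i)
  clear_value K
  set S : Fin s → Finset ℕ := fun i => Finset.Ico (K i) (2 * K i) with hS
  have hScard : ∀ i, (S i).card = K i := fun i => by
    rw [hS, Nat.card_Ico]; omega
  have hulow : ∀ i, ∀ k ∈ S i, α / B * (θ i * L) ≤ u i k := by
    intro i k hk
    obtain ⟨hk1, hk2, -⟩ := (hb i).2.2.2 k hk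
    refine le_trans ?_ (hlow i k hk1)
    calc α / B * (θ i * L) = α * (θ i * L / B) := by ring
      _ ≤ α * (θ i * L / 2 ^ ρ i) := by
        have := hBi i
        have := hθ0 i
        gcongr
      _ ≤ α * (k : ℝ) ^ ρ i := by gcongr
  have huup : ∀ i, ∀ k ∈ S i, (u i k : ℝ) < B * (θ i * L) := by
    intro i k hk
    obtain ⟨hk1, -, hk2⟩ := (hb i).2.2.2 k hk
    refine (hup i k hk1).trans_lt (hk2.trans_le ?_)
    have := hBi i
    have := hθ0 i
    gcongr
  have hupos : ∀ i, ∀ k ∈ S i, 1 ≤ u i k := by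
    intro i k hk
    have h1 := hulow i k hk
    have h2 : 0 < α / B * (θ i * L) := by have := hθ0 i; positivity
    exact_mod_cast h2.trans_le h1
  have hult : ∀ i, ∀ k ∈ S i, u i k < L := by
    intro i k hk
    have h1 := huup i k hk
    have h2 : B * (θ i * L) ≤ L := by
      have : B * θ i = q ^ (i : ℕ) * (q * B) := by rw [hθ]; ring
      rw [← mul_assoc, this, hqB]
      have h3 : q ^ (i : ℕ) * (α / B) ≤ 1 :=
        mul_le_one₀ (pow_le_one₀ hq0.le hq1) (by positivity) hαB
      nlinarith
    exact_mod_cast h1.trans_le h2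
  have hdisj : ∀ i j : Fin s, i < j → ∀ k ∈ S i, ∀ l ∈ S j, u j l < u i k := by
    intro i j hij k hk l hl
    have h1 := hulow i k hk
    have h2 := huup j l hl
    have h3 : B * (θ j * L) ≤ α / B * (θ i * L) := by
      have h4 : θ j ≤ q * θ i := by
        have : q * θ i = q ^ ((i : ℕ) + 2) := by rw [hθ]; ring
        rw [this]
        have hij' : (i : ℕ) < j := hij
        exact pow_le_pow_of_le_one hq0.le hq1 (by omega)
      calc B * (θ j * L) ≤ B * (q * θ i * L) := by gcongr
        _ = (q * B) * (θ i * L) := by ring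
        _ = _ := by rw [hqB]
    exact_mod_cast h2.trans_le (h3.trans h1)
  have hsep : ∀ i j, ∀ k ∈ S i, ∀ l ∈ S j, u i k = u j l → i = j ∧ k = l := by
    intro i j k hk l hl h
    rcases lt_trichotomy i j with hij | hij | hij
    · exact absurd h (hdisj i j hij k hk l hl).ne'
    · subst hij
      exact ⟨rfl, (hmono i).injective h⟩
    · exact absurd h (hdisj j i hij l hl k hk).ne
  clear_value θ q B
  have hcard : ((Fintype.piFinset S).image fun k => ∑ i, 2 ^ u i (k i)).card = ∏ i, K i := by
    rw [Finset.card_image_of_injOn (injOn_sum_two_pow u S hsep), Fintype.card_piFinset]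
    exact Finset.prod_congr rfl fun i _ => hScard i
  have hKup : ((∏ i, K i : ℕ) : ℝ) ≤ Θ * L := by
    rw [Nat.cast_prod, ← hprod L hL1]
    exact Finset.prod_le_prod (fun i _ => by positivity) fun i _ => (hb i).2.1
  have hKlow : Θ / 2 ^ s * L ≤ ((∏ i, K i : ℕ) : ℝ) := by
    have h1 : Θ / 2 ^ s * L = ∏ i, ((θ i * L) ^ (ρ i)⁻¹ / 2) := by
      rw [Finset.prod_div_distrib, hprod L hL1, Finset.prod_const, Finset.card_univ,
        Fintype.card_fin]
      ring
    rw [h1, Nat.cast_prod]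
    refine Finset.prod_le_prod (fun i _ => ?_) fun i _ => (hb i).2.2.1
    exact div_nonneg (Real.rpow_nonneg (zero_le_one.trans (hY i)) _) zero_le_two
  refine ⟨(Fintype.piFinset S).image fun k => ∑ i, 2 ^ u i (k i), ?_, ?_, ?_, ?_, ?_⟩
  · intro a ha
    obtain ⟨k, hk, rfl⟩ := Finset.mem_image.1 ha
    rw [Fintype.mem_piFinset] at hk
    exact ⟨k, fun i => ((hb i).2.2.2 _ (hk i)).1, rfl⟩
  · intro a ha
    obtain ⟨k, hk, rfl⟩ := Finset.mem_image.1 ha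
    rw [Fintype.mem_piFinset] at hk
    refine ⟨?_, sum_two_pow_lt (fun i j hij => (hsep i j _ (hk i) _ (hk j) hij).1)
      fun i => hult i _ (hk i)⟩
    rw [even_iff_two_dvd]
    exact Finset.dvd_sum fun i _ => dvd_pow_self 2 (by have := hupos i _ (hk i); omega)
  · rw [hcard]; exact hKlow
  · rw [hcard]
    refine hKup.trans ?_
    have : Θ ≤ Θ * (1 + C * (1 + C')) := le_mul_of_one_le_right hΘ0.le (by
      have : 0 < C * (1 + C') := by positivity
      linarith)
    gcongr
  · intro p b hp hp2
    set e := orderOf (2 : ZMod p) with he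
    have he1 : 1 ≤ e := orderOf_two_pos hp hp2
    have he1' : (1 : ℝ) ≤ e := by exact_mod_cast he1
    have hKpos : (0 : ℝ) < K i₀ := by exact_mod_cast (hb i₀).1
    set W : ℝ := C * K i₀ * ((e : ℝ) ^ (-δ) + (K i₀ : ℝ) ^ (-δ)) with hW
    have hW0 : 0 ≤ W := by positivity
    have h1 := card_filter_image_sum_two_pow_le u S i₀ hp hp2 b ⌊W⌋₊ fun c =>
      Nat.le_floor (hdist (K i₀) e c (hb i₀).1 he1)
    have h2 : ((((Fintype.piFinset S).image fun k => ∑ i, 2 ^ u i (k i)).filter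
        fun a => a ≡ b [MOD p]).card : ℝ) ≤
        W * ((∏ i ∈ Finset.univ \ {i₀}, K i : ℕ) : ℝ) := by
      rw [Finset.prod_congr rfl fun i _ => hScard i] at h1
      calc _ ≤ ((⌊W⌋₊ * ∏ i ∈ Finset.univ \ {i₀}, K i : ℕ) : ℝ) := by exact_mod_cast h1
        _ ≤ _ := by
          rw [Nat.cast_mul]
          exact mul_le_mul_of_nonneg_right (Nat.floor_le hW0) (by positivity)
    have h3 : W * ((∏ i ∈ Finset.univ \ {i₀}, K i : ℕ) : ℝ) =
        C * ((∏ i, K i : ℕ) : ℝ) * ((e : ℝ) ^ (-δ) + (K i₀ : ℝ) ^ (-δ)) := by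
      rw [← Finset.mul_prod_erase _ _ (Finset.mem_univ i₀), hW, Finset.sdiff_singleton_eq_erase]
      push_cast
      ring
    have h4 : (e : ℝ) ^ (-δ) ≤ (e : ℝ) ^ (-δ') :=
      Real.rpow_le_rpow_of_exponent_le he1' (neg_le_neg hδ1)
    have h5 : (K i₀ : ℝ) ^ (-δ) ≤ C' * (L : ℝ) ^ (-δ') := by
      have hX := (hb i₀).2.2.1
      have hX0 : 0 < (θ i₀ * L) ^ (ρ i₀)⁻¹ / 2 :=
        div_pos (Real.rpow_pos_of_pos (zero_lt_one.trans_le (hY i₀)) _) zero_lt_two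
      calc (K i₀ : ℝ) ^ (-δ) ≤ ((θ i₀ * L) ^ (ρ i₀)⁻¹ / 2) ^ (-δ) :=
            Real.rpow_le_rpow_of_nonpos hX0 hX (by linarith)
        _ = C' * (L : ℝ) ^ (-(δ * (ρ i₀)⁻¹)) := by
          rw [Real.mul_rpow (hθ0 i₀).le hL0.le, mul_div_right_comm, Real.mul_rpow
            (by have := Real.rpow_pos_of_pos (hθ0 i₀) (ρ i₀)⁻¹; positivity) (by positivity),
            ← Real.rpow_mul hL0.le, hC']
          congr 2
          ring
        _ ≤ C' * (L : ℝ) ^ (-δ') := by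
          refine mul_le_mul_of_nonneg_left ?_ hC'0.le
          exact Real.rpow_le_rpow_of_exponent_le (by exact_mod_cast hL1)
            (neg_le_neg hδ2)
    rw [h3] at h2
    refine h2.trans ?_
    have hE0 : 0 ≤ (e : ℝ) ^ (-δ') := by positivity
    have hLL0 : 0 ≤ (L : ℝ) ^ (-δ') := by positivity
    calc C * ((∏ i, K i : ℕ) : ℝ) * ((e : ℝ) ^ (-δ) + (K i₀ : ℝ) ^ (-δ))
        ≤ C * (Θ * L) * ((1 + C') * ((e : ℝ) ^ (-δ') + (L : ℝ) ^ (-δ'))) := by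
          refine mul_le_mul (by gcongr) ?_ (by positivity) (by positivity)
          nlinarith
      _ = Θ * (C * (1 + C')) * L * ((e : ℝ) ^ (-δ') + (L : ℝ) ^ (-δ')) := by ring
      _ ≤ _ := by
          have : Θ * (C * (1 + C')) ≤ Θ * (1 + C * (1 + C')) := by
            refine mul_le_mul_of_nonneg_left ?_ hΘ0.le
            linarith
          gcongr

open scoped Pointwise in
/-- A finite subset of a set of naturals which equidistributes well enough at every scale `2 ^ L`
yields positive lower density of the sumset with the primes. -/
lemma exists_le_ncard_prime_add {R : Set ℕ} {δ C₀ c₀ : ℝ} (hδ : 0 < δ) (hC₀ : 0 < C₀)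
    (hc₀ : 0 < c₀) {L₀ : ℕ}
    (h : ∀ L : ℕ, L₀ ≤ L → ∃ A : Finset ℕ, (∀ a ∈ A, a ∈ R) ∧
      (∀ a ∈ A, Even a ∧ a < 2 ^ L) ∧ c₀ * L ≤ A.card ∧ (A.card : ℝ) ≤ C₀ * L ∧
      ∀ p b : ℕ, p.Prime → p ≠ 2 → ((A.filter fun a => a ≡ b [MOD p]).card : ℝ) ≤
        C₀ * L * ((orderOf (2 : ZMod p) : ℝ) ^ (-δ) + (L : ℝ) ^ (-δ))) :
    ∃ c > (0 : ℝ), ∃ x₀ : ℝ, ∀ x : ℝ, x₀ ≤ x →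
      c * x ≤ (({n : ℕ | (n : ℝ) ≤ x ∧ ∃ p a : ℕ, p.Prime ∧
        a ∈ R ∧ n = p + a} : Set ℕ).ncard : ℝ) := by
  classical
  obtain ⟨c, hc, hmain⟩ := exists_le_card_primesBelow_add hδ hC₀ hc₀
  refine ⟨c / 4, by positivity, 2 ^ (max L₀ 24 + 1), fun x hx => ?_⟩
  have hx0 : 0 ≤ x := le_trans (by positivity) hx
  have hN : 2 ^ (max L₀ 24 + 1) ≤ ⌊x⌋₊ := Nat.le_floor (by exact_mod_cast hx)
  have hN0 : ⌊x⌋₊ ≠ 0 := by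
    have : 0 < 2 ^ (max L₀ 24 + 1) := by positivity
    omega
  obtain ⟨L, hL⟩ : ∃ L, Nat.log 2 ⌊x⌋₊ = L + 1 :=
    ⟨Nat.log 2 ⌊x⌋₊ - 1, by have := Nat.le_log_of_pow_le one_lt_two hN; omega⟩
  have hLge : max L₀ 24 ≤ L := by
    have := Nat.le_log_of_pow_le one_lt_two hN
    omega
  have hlow : 2 ^ (L + 1) ≤ ⌊x⌋₊ := hL ▸ Nat.pow_log_le_self 2 hN0
  have hupp : ⌊x⌋₊ < 2 ^ (L + 2) := by
    have := Nat.lt_pow_succ_log_self one_lt_two ⌊x⌋₊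
    rwa [hL] at this
  obtain ⟨A, hAR, hA, hAlow, hAup, hAp⟩ := h L ((le_max_left _ _).trans hLge)
  have hcount := hmain L A ((le_max_right _ _).trans hLge) hA hAlow hAup hAp
  have hfin : ({n : ℕ | (n : ℝ) ≤ x ∧ ∃ p a : ℕ, p.Prime ∧ a ∈ R ∧ n = p + a} : Set ℕ).Finite :=
    (Set.finite_Iic ⌊x⌋₊).subset fun n hn => Nat.le_floor hn.1
  have hsub : (((2 ^ L).primesBelow + A : Finset ℕ) : Set ℕ) ⊆
      {n : ℕ | (n : ℝ) ≤ x ∧ ∃ p a : ℕ, p.Prime ∧ a ∈ R ∧ n = p + a} := by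
    intro n hn
    rw [Finset.mem_coe, Finset.mem_add] at hn
    obtain ⟨p, hp, a, ha, rfl⟩ := hn
    rw [Nat.mem_primesBelow] at hp
    have ha2 := (hA a ha).2
    refine ⟨?_, p, a, hp.2, hAR a ha, rfl⟩
    refine le_trans ?_ (Nat.floor_le hx0)
    have : p + a ≤ ⌊x⌋₊ := by rw [pow_succ] at hlow; omega
    exact_mod_cast this
  have hle := Set.ncard_le_ncard hsub hfin
  rw [Set.ncard_coe_finset] at hle
  have hx4 : x < 4 * 2 ^ L := by
    have h1 : x < ⌊x⌋₊ + 1 := Nat.lt_floor_add_one x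
    have h2 : ((⌊x⌋₊ + 1 : ℕ) : ℝ) ≤ ((2 ^ (L + 2) : ℕ) : ℝ) := by exact_mod_cast hupp
    push_cast at h2
    rw [pow_add] at h2
    linarith
  calc c / 4 * x ≤ c / 4 * (4 * 2 ^ L) := by gcongr
    _ = c * 2 ^ L := by ring
    _ ≤ _ := hcount
    _ ≤ _ := by exact_mod_cast hle

lemma two_rpow_neg_mul_rpow_le_natFloor {lam r : ℝ} (hlam : 1 ≤ lam) (hr : 1 ≤ r) {k : ℕ}
    (hk : 1 ≤ k) :
    2 ^ (-r) / 2 * (k : ℝ) ^ (lam * r) ≤ (⌊((⌊(k : ℝ) ^ lam⌋₊ : ℕ) : ℝ) ^ r⌋₊ : ℝ) := by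
  have hk' : (1 : ℝ) ≤ k := by exact_mod_cast hk
  have h1 : (1 : ℝ) ≤ (k : ℝ) ^ lam := Real.one_le_rpow hk' (by linarith)
  have h2 := half_le_natFloor h1
  have h3 : (1 : ℝ) ≤ (⌊(k : ℝ) ^ lam⌋₊ : ℝ) := by
    exact_mod_cast Nat.le_floor (by simpa using h1)
  refine le_trans ?_ (half_le_natFloor (Real.one_le_rpow h3 (by linarith)))
  calc 2 ^ (-r) / 2 * (k : ℝ) ^ (lam * r) = ((k : ℝ) ^ lam / 2) ^ r / 2 := by
        rw [Real.div_rpow (by positivity) (by norm_num), ← Real.rpow_mul (by positivity),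
          Real.rpow_neg (by norm_num)]
        ring
    _ ≤ _ := by gcongr

/-- the sumset `P + A` has positive lower asymptotic density. -/
theorem romA_sumset_density (s : ℕ) (hs : 2 ≤ s) (r : Fin s → ℝ) (hr : ∀ i, 1 < r i)
    (hri : ∀ i, ∀ m : ℤ, r i ≠ m) (lam : ℝ) (hlam : 1 ≤ lam)
    (hsum : (∑ i ∈ Finset.univ.filter (fun i : Fin s => (i : ℕ) < s - 1), (r i)⁻¹)
      + (lam * r ⟨s - 1, by omega⟩)⁻¹ = 1) :
    ∃ c > (0 : ℝ), ∃ x₀ : ℝ, ∀ x : ℝ, x₀ ≤ x →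
      c * x ≤ (({n : ℕ | (n : ℝ) ≤ x ∧ ∃ p a : ℕ, p.Prime ∧
        a ∈ romA s (by omega) r lam ∧ n = p + a} : Set ℕ).ncard : ℝ) := by
  set l : Fin s := ⟨s - 1, by omega⟩ with hl
  set i₀ : Fin s := ⟨0, by omega⟩ with hi₀
  have hlt : ∀ i : Fin s, (i : ℕ) < s - 1 ↔ i ≠ l := by
    intro i
    rw [Ne, Fin.ext_iff, hl]
    have := i.2
    simp only
    omega
  have hfilter : Finset.univ.filter (fun i : Fin s => (i : ℕ) < s - 1) = Finset.univ.erase l := by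
    ext i
    rw [Finset.mem_filter, Finset.mem_erase, hlt]
    tauto
  have hi₀l : i₀ ≠ l := (hlt i₀).1 (by rw [hi₀]; simp only; omega)
  set ρ : Fin s → ℝ := fun i => if i = l then lam * r l else r i with hρ
  set u : Fin s → ℕ → ℕ := fun i k =>
    if i = l then ⌊((⌊(k : ℝ) ^ lam⌋₊ : ℕ) : ℝ) ^ r l⌋₊ else ⌊(k : ℝ) ^ r i⌋₊ with hu
  have hρl : ρ l = lam * r l := if_pos rfl
  have hρi : ∀ i, i ≠ l → ρ i = r i := fun i hi => if_neg hi
  have hul : ∀ k, u l k = ⌊((⌊(k : ℝ) ^ lam⌋₊ : ℕ) : ℝ) ^ r l⌋₊ := fun k => if_pos rfl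
  have hui : ∀ i, i ≠ l → ∀ k, u i k = ⌊(k : ℝ) ^ r i⌋₊ := fun i hi k => if_neg hi
  clear_value ρ u
  have hr0 : ∀ i, 0 < r i := fun i => zero_lt_one.trans (hr i)
  have hρ0 : ∀ i, 0 < ρ i := by
    intro i
    by_cases hi : i = l
    · rw [hi, hρl]; exact mul_pos (by linarith) (hr0 l)
    · rw [hρi i hi]; exact hr0 i
  have hsum' : ∑ i, (ρ i)⁻¹ = 1 := by
    rw [← Finset.sum_erase_add _ _ (Finset.mem_univ l), hρl, ← hsum, hfilter]
    congr 1
    exact Finset.sum_congr rfl fun i hi => by rw [hρi i (Finset.ne_of_mem_erase hi)]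
  have hα1 : (2 : ℝ) ^ (-r l) ≤ 1 :=
    Real.rpow_le_one_of_one_le_of_nonpos (by norm_num) (neg_nonpos.2 (hr0 l).le)
  have hlow : ∀ i (k : ℕ), 1 ≤ k → 2 ^ (-r l) / 2 * (k : ℝ) ^ ρ i ≤ u i k := by
    intro i k hk
    by_cases hi : i = l
    · rw [hi, hρl, hul]
      exact two_rpow_neg_mul_rpow_le_natFloor hlam (hr l).le hk
    · rw [hρi i hi, hui i hi]
      have h1 : (1 : ℝ) ≤ (k : ℝ) ^ r i :=
        Real.one_le_rpow (by exact_mod_cast hk) (hr0 i).le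
      have h2 := half_le_natFloor h1
      nlinarith
  have hup : ∀ i (k : ℕ), 1 ≤ k → (u i k : ℝ) ≤ (k : ℝ) ^ ρ i := by
    intro i k _
    by_cases hi : i = l
    · rw [hi, hρl, hul, Real.rpow_mul (Nat.cast_nonneg k)]
      refine (Nat.floor_le (by positivity)).trans ?_
      exact Real.rpow_le_rpow (by positivity) (Nat.floor_le (by positivity)) (hr0 l).le
    · rw [hρi i hi, hui i hi]
      exact Nat.floor_le (by positivity)
  have hmono : ∀ i, StrictMono (u i) := by
    intro i m n hmn
    by_cases hi : i = l
    · rw [hi, hul, hul]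
      exact natFloor_rpow_lt_natFloor_rpow (hr l).le (natFloor_rpow_lt_natFloor_rpow hlam hmn)
    · rw [hui i hi, hui i hi]
      exact natFloor_rpow_lt_natFloor_rpow (hr i).le hmn
  have hdist := exists_card_filter_floor_rpow_modEq_le (hr i₀) (hri i₀)
  simp only [← hui i₀ hi₀l] at hdist
  obtain ⟨δ, hδ, C₀, hC₀, c₀, hc₀, L₀, hA⟩ := exists_finset_sum_two_pow hρ0 hsum'
    (by positivity) (by linarith) hlow hup hmono i₀ hdist
  refine exists_le_ncard_prime_add hδ hC₀ hc₀ (L₀ := L₀) fun L hL => ?_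
  obtain ⟨A, hAk, hA'⟩ := hA L hL
  refine ⟨A, fun a ha => ?_, hA'⟩
  obtain ⟨k, hk, rfl⟩ := hAk a ha
  refine ⟨k, hk, ?_⟩
  rw [hfilter, ← Finset.sum_erase_add _ _ (Finset.mem_univ l), hul]
  congr 1
  exact Finset.sum_congr rfl fun i hi => by rw [hui i (Finset.ne_of_mem_erase hi)]
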